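/- arXiv:math/0108093 — 2 statements merged into one kernel-verified Lean document; each statement's English description precedes it below -/
import Mathlib

section
/- Let k ≥ 0 and μ ≥ 1 be integers (μ = ∞ allowed). Suppose L₁(·; x), …, Lₙ(·; x) are vector fields on a neighborhood of 0 in ℂ^m (n ≤ m) depending on a parameter x in an open subset of ℝ^q, which are jointly of class C^μ in (Z, x) and holomorphic in Z for each fixed x, with L₁(Z; x), …, Lₙ(Z; x) linearly independent at every point, and suppose there exist functions c^s_{i,j}(Z; x) of class C^μ, holomorphic in Z for each fixed x, such that [L_i(·;x), L_j(·;x)](Z) = Σ_{s=1}^n c^s_{i,j}(Z; x) L_s(Z; x) + o(|Z|^k) as Z → 0 for each fixed x. Then there exist vector fields L̃₁(·;x), …, L̃ₙ(·;x) and a family of local biholomorphic coordinate changes Z̃(·; x) fixing 0, all jointly of class C^μ in (Z, x) and holomorphic in Z for each fixed x, such that for each fixed x the fields L̃_i(·;x) span the same subspace as L₁(·;x), …, Lₙ(·;x) at every point and, in the coordinates Z̃(·;x), one has L̃_i = ∂/∂Z̃_i + o(|Z̃|^{k+1}) as Z̃ → 0 for 1 ≤ i ≤ n. -/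
open Asymptotics Topology

/-- The Lie bracket of two (holomorphic) vector fields, viewed as maps `E → E`:
`[L, L'](Z) = DL'(Z)·L(Z) − DL(Z)·L'(Z)`. -/
noncomputable def lieBracketVF {E : Type*} [NormedAddCommGroup E] [NormedSpace ℂ E]
    (L L' : E → E) : E → E :=
  fun Z => fderiv ℂ L' Z (L Z) - fderiv ℂ L Z (L' Z)

section ApproximateFrobenius

open Filter Set Metric

universe u

section ParametricIntegral

theorem isOpen_setOf_forall_mem_of_isCompact {H T : Type*} [TopologicalSpace H]
    [TopologicalSpace T] {S : Set (H × T)} (hS : IsOpen S) {I : Set T} (hI : IsCompact I) :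
    IsOpen {p : H | ∀ t ∈ I, (p, t) ∈ S} := by
  rw [isOpen_iff_mem_nhds]
  intro p hp
  exact hI.eventually_forall_of_forall_eventually fun t ht => hS.mem_nhds (hp t ht)

theorem ContinuousOn.prodMk_right_of_forall_mem {H T F : Type*} [TopologicalSpace H]
    [TopologicalSpace T] [TopologicalSpace F] {Ψ : H × T → F} {S : Set (H × T)}
    (hΨ : ContinuousOn Ψ S) {p : H} {I : Set T} (hp : ∀ t ∈ I, (p, t) ∈ S) :
    ContinuousOn (fun t => Ψ (p, t)) I :=
  hΨ.comp (Continuous.prodMk_right p).continuousOn hp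

theorem hasFDerivAt_intervalIntegral_of_continuousOn {𝕜 H G : Type*} [RCLike 𝕜]
    [NormedAddCommGroup H] [NormedSpace 𝕜 H] [NormedAddCommGroup G] [NormedSpace ℝ G]
    [NormedSpace 𝕜 G] [CompleteSpace G] {a b : ℝ} {S : Set (H × ℝ)} (hS : IsOpen S)
    {Φ : H × ℝ → G} {Φ' : H × ℝ → H →L[𝕜] G} (hΦ : ContinuousOn Φ S) (hΦ' : ContinuousOn Φ' S)
    (hd : ∀ y ∈ S, HasFDerivAt (fun p => Φ (p, y.2)) (Φ' y) y.1) {p₀ : H}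
    (hp₀ : ∀ t ∈ uIcc a b, (p₀, t) ∈ S) :
    HasFDerivAt (fun p => ∫ t in a..b, Φ (p, t)) (∫ t in a..b, Φ' (p₀, t)) p₀ := by
  obtain ⟨C, hC⟩ := isCompact_uIcc.exists_bound_of_continuousOn (hΦ'.prodMk_right_of_forall_mem hp₀)
  have hbd : ∀ᶠ p in 𝓝 p₀, ∀ t ∈ uIcc a b, (p, t) ∈ S ∧ ‖Φ' (p, t)‖ ≤ C + 1 := by
    refine isCompact_uIcc.eventually_forall_of_forall_eventually fun t ht => ?_
    have h1 : ∀ᶠ z in 𝓝 (p₀, t), ‖Φ' z‖ < C + 1 :=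
      (hΦ'.continuousAt (hS.mem_nhds (hp₀ t ht))).norm.eventually_lt_const
        ((hC t ht).trans_lt (lt_add_one C))
    filter_upwards [h1, hS.mem_nhds (hp₀ t ht)] with z hz hzS using ⟨hzS, hz.le⟩
  refine intervalIntegral.hasFDerivAt_integral_of_dominated_of_fderiv_le (H := H) (E := G)
    (F := fun p t => Φ (p, t)) (F' := fun p t => Φ' (p, t)) (bound := fun _ => C + 1)
    hbd ?_ ?_ ?_ ?_ ?_ ?_
  · filter_upwards [hbd] with p hp
    exact ((hΦ.prodMk_right_of_forall_mem fun t ht => (hp t ht).1).mono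
      uIoc_subset_uIcc).aestronglyMeasurable measurableSet_uIoc
  · exact (hΦ.prodMk_right_of_forall_mem hp₀).intervalIntegrable
  · exact ((hΦ'.prodMk_right_of_forall_mem hp₀).mono uIoc_subset_uIcc).aestronglyMeasurable
      measurableSet_uIoc
  · exact .of_forall fun t ht p hp => (hp t (uIoc_subset_uIcc ht)).2
  · exact intervalIntegrable_const
  · exact .of_forall fun t ht p hp => hd (p, t) (hp t (uIoc_subset_uIcc ht)).1

theorem ContDiffOn.intervalIntegral_nat {H G : Type u}
    [NormedAddCommGroup H] [NormedSpace ℝ H] [NormedAddCommGroup G] [NormedSpace ℝ G]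
    [CompleteSpace G] {a b : ℝ} {S : Set (H × ℝ)} (hS : IsOpen S) (n : ℕ)
    {Φ : H × ℝ → G} (hΦ : ContDiffOn ℝ n Φ S) :
    ContDiffOn ℝ n (fun p => ∫ t in a..b, Φ (p, t)) {p | ∀ t ∈ uIcc a b, (p, t) ∈ S} := by
  induction n generalizing G with
  | zero =>
    rw [Nat.cast_zero, contDiffOn_zero] at *
    intro p hp
    refine ContinuousAt.continuousWithinAt ?_
    obtain ⟨C, hC⟩ := isCompact_uIcc.exists_bound_of_continuousOn
      (hΦ.prodMk_right_of_forall_mem hp)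
    have hbd : ∀ᶠ q in 𝓝 p, ∀ t ∈ uIcc a b, (q, t) ∈ S ∧ ‖Φ (q, t)‖ ≤ C + 1 := by
      refine isCompact_uIcc.eventually_forall_of_forall_eventually fun t ht => ?_
      have h1 : ∀ᶠ z in 𝓝 (p, t), ‖Φ z‖ < C + 1 :=
        (hΦ.continuousAt (hS.mem_nhds (hp t ht))).norm.eventually_lt_const
          ((hC t ht).trans_lt (lt_add_one C))
      filter_upwards [h1, hS.mem_nhds (hp t ht)] with z hz hzS using ⟨hzS, hz.le⟩
    refine intervalIntegral.continuousAt_of_dominated_interval (bound := fun _ => C + 1) ?_ ?_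
      intervalIntegrable_const ?_
    · filter_upwards [hbd] with q hq
      exact (hΦ.prodMk_right_of_forall_mem
        fun t ht => (hq t (uIoc_subset_uIcc ht)).1).aestronglyMeasurable measurableSet_uIoc
    · filter_upwards [hbd] with q hq
      exact .of_forall fun t ht => (hq t (uIoc_subset_uIcc ht)).2
    · exact .of_forall fun t ht =>
        (hΦ.continuousAt (hS.mem_nhds (hp t (uIoc_subset_uIcc ht)))).comp
          (f := fun q => (q, t)) (Continuous.prodMk_left t).continuousAt
  | succ n ih =>
    have hW := isOpen_setOf_forall_mem_of_isCompact hS (isCompact_uIcc (a := a) (b := b))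
    rw [Nat.cast_add, Nat.cast_one] at *
    have hΦ' : ContDiffOn ℝ n
        (fun y => (fderiv ℝ Φ y).comp (ContinuousLinearMap.inl ℝ H ℝ)) S :=
      (((contDiffOn_succ_iff_fderiv_of_isOpen hS).1 hΦ).2.2).clm_comp contDiffOn_const
    have hd : ∀ p ∈ {p | ∀ t ∈ uIcc a b, (p, t) ∈ S},
        HasFDerivAt (fun p => ∫ t in a..b, Φ (p, t))
          (∫ t in a..b, (fderiv ℝ Φ (p, t)).comp (ContinuousLinearMap.inl ℝ H ℝ)) p := by
      intro p hp
      refine hasFDerivAt_intervalIntegral_of_continuousOn hS hΦ.continuousOn hΦ'.continuousOn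
        (fun y hy => ?_) hp
      have h1 : HasFDerivAt Φ (fderiv ℝ Φ y) (y.1, y.2) :=
        ((hΦ.differentiableOn (by simp)).differentiableAt (hS.mem_nhds hy)).hasFDerivAt
      exact h1.comp y.1 (hasFDerivAt_prodMk_left y.1 y.2)
    refine (contDiffOn_succ_iff_fderiv_of_isOpen hW).2
      ⟨fun p hp => (hd p hp).differentiableAt.differentiableWithinAt, by simp, ?_⟩
    exact (ih hΦ').congr fun p hp => (hd p hp).fderiv

theorem ContDiffOn.intervalIntegral {H G : Type u}
    [NormedAddCommGroup H] [NormedSpace ℝ H] [NormedAddCommGroup G] [NormedSpace ℝ G]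
    [CompleteSpace G] {a b : ℝ} {S : Set (H × ℝ)} (hS : IsOpen S) {μ : ℕ∞}
    {Φ : H × ℝ → G} (hΦ : ContDiffOn ℝ μ Φ S) :
    ContDiffOn ℝ μ (fun p => ∫ t in a..b, Φ (p, t)) {p | ∀ t ∈ uIcc a b, (p, t) ∈ S} := by
  rw [contDiffOn_iff_forall_nat_le]
  exact fun n hn => ContDiffOn.intervalIntegral_nat hS n (hΦ.of_le (mod_cast hn))

end ParametricIntegral

section SmoothHol

variable {E Y G G' : Type u} [NormedAddCommGroup E] [NormedSpace ℂ E]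
  [NormedAddCommGroup Y] [NormedSpace ℝ Y] [NormedAddCommGroup G] [NormedSpace ℂ G]
  [NormedAddCommGroup G'] [NormedSpace ℂ G'] {μ : ℕ∞} {x₀ : Y}

/-- `f (Z, x)` is jointly `C^μ` and holomorphic in `Z` near `(0, x₀)`. -/
def SmoothHolAt (μ : ℕ∞) (f : E × Y → G) (x₀ : Y) : Prop :=
  ∀ᶠ p in 𝓝 ((0 : E), x₀), ContDiffAt ℝ μ f p ∧ DifferentiableAt ℂ (fun Z => f (Z, p.2)) p.1

namespace SmoothHolAt

theorem contDiffAt {f : E × Y → G} (hf : SmoothHolAt μ f x₀) : ContDiffAt ℝ μ f (0, x₀) :=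
  hf.self_of_nhds.1

theorem eventually {f : E × Y → G} (hf : SmoothHolAt μ f x₀) :
    ∀ᶠ x in 𝓝 x₀, SmoothHolAt μ f x :=
  (Continuous.tendsto (by fun_prop : Continuous fun x : Y => ((0 : E), x)) x₀).eventually
    (eventually_eventually_nhds.2 hf)

theorem congr {f g : E × Y → G} (hf : SmoothHolAt μ f x₀) (h : g =ᶠ[𝓝 (0, x₀)] f) :
    SmoothHolAt μ g x₀ := by
  filter_upwards [hf, eventually_eventually_nhds.2 h] with p hp hgp
  refine ⟨hp.1.congr_of_eventuallyEq hgp, hp.2.congr_of_eventuallyEq ?_⟩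
  exact (Continuous.tendsto (by fun_prop : Continuous fun Z : E => (Z, p.2)) p.1).eventually hgp

theorem prodMk {f : E × Y → G} {g : E × Y → G'} (hf : SmoothHolAt μ f x₀)
    (hg : SmoothHolAt μ g x₀) : SmoothHolAt μ (fun p => (f p, g p)) x₀ := by
  filter_upwards [hf, hg] with p hp hp'
  exact ⟨hp.1.prodMk hp'.1, hp.2.prodMk hp'.2⟩

open scoped ContDiff in
theorem comp {h : G → G'} {f : E × Y → G} (hh : ContDiffAt ℂ ω h (f (0, x₀)))
    (hf : SmoothHolAt μ f x₀) : SmoothHolAt μ (fun p => h (f p)) x₀ := by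
  have h1 := hf.contDiffAt.continuousAt.eventually (hh.eventually (by simp))
  filter_upwards [hf, h1] with p hp hp'
  refine ⟨ContDiffAt.comp p ((hp'.restrict_scalars ℝ).of_le le_top) hp.1, ?_⟩
  exact (hp'.differentiableAt (by simp)).comp p.1 hp.2

theorem const (c : G) : SmoothHolAt μ (fun _ : E × Y => c) x₀ :=
  .of_forall fun _ => ⟨contDiffAt_const, differentiableAt_const _⟩

theorem fst : SmoothHolAt μ (fun p : E × Y => p.1) x₀ :=
  .of_forall fun _ => ⟨contDiffAt_fst, differentiableAt_fun_id⟩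

theorem at_zero {f : E × Y → G} (hf : SmoothHolAt μ f x₀) :
    SmoothHolAt μ (fun p : E × Y => f (0, p.2)) x₀ := by
  have h1 : Tendsto (fun p : E × Y => ((0 : E), p.2)) (𝓝 (0, x₀)) (𝓝 (0, x₀)) :=
    Continuous.tendsto (by fun_prop) (0, x₀)
  filter_upwards [h1.eventually hf] with p hp
  refine ⟨?_, differentiableAt_const _⟩
  exact ContDiffAt.comp (g := f) (f := fun p : E × Y => ((0 : E), p.2)) p hp.1 (by fun_prop)

theorem add {f g : E × Y → G} (hf : SmoothHolAt μ f x₀) (hg : SmoothHolAt μ g x₀) :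
    SmoothHolAt μ (fun p => f p + g p) x₀ :=
  comp (h := fun z : G × G => z.1 + z.2) (by fun_prop) (hf.prodMk hg)

theorem sub {f g : E × Y → G} (hf : SmoothHolAt μ f x₀) (hg : SmoothHolAt μ g x₀) :
    SmoothHolAt μ (fun p => f p - g p) x₀ :=
  comp (h := fun z : G × G => z.1 - z.2) (by fun_prop) (hf.prodMk hg)

theorem sum {ι : Type*} (s : Finset ι) {f : ι → E × Y → G} (hf : ∀ i ∈ s, SmoothHolAt μ (f i) x₀) :
    SmoothHolAt μ (fun p => ∑ i ∈ s, f i p) x₀ := by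
  classical
  induction s using Finset.induction_on with
  | empty => simpa using const 0
  | insert i s his ih =>
    simp only [Finset.sum_insert his]
    exact (hf i (by simp)).add (ih fun j hj => hf j (by simp [hj]))

theorem clm_const (A : G →L[ℂ] G') {f : E × Y → G} (hf : SmoothHolAt μ f x₀) :
    SmoothHolAt μ (fun p => A (f p)) x₀ :=
  comp (h := A) A.contDiff.contDiffAt hf

theorem clm_apply {A : E × Y → G →L[ℂ] G'} {f : E × Y → G} (hA : SmoothHolAt μ A x₀)
    (hf : SmoothHolAt μ f x₀) : SmoothHolAt μ (fun p => A p (f p)) x₀ :=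
  comp (h := fun z : (G →L[ℂ] G') × G => z.1 z.2) (by fun_prop) (hA.prodMk hf)

theorem clm_comp {G'' : Type u} [NormedAddCommGroup G''] [NormedSpace ℂ G'']
    {A : E × Y → G' →L[ℂ] G''} {B : E × Y → G →L[ℂ] G'} (hA : SmoothHolAt μ A x₀)
    (hB : SmoothHolAt μ B x₀) : SmoothHolAt μ (fun p => (A p).comp (B p)) x₀ :=
  comp (h := fun z : (G' →L[ℂ] G'') × (G →L[ℂ] G') => z.1.comp z.2) (by fun_prop) (hA.prodMk hB)

theorem intervalIntegral [CompleteSpace G] (hμ : 1 ≤ μ) {a b : ℝ} {Φ : (E × Y) × ℝ → G}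
    (hΦ : ∀ t ∈ uIcc a b, ∀ᶠ y in 𝓝 (((0 : E), x₀), t), ContDiffAt ℝ μ Φ y ∧
      DifferentiableAt ℂ (fun Z => Φ ((Z, y.1.2), y.2)) y.1.1) :
    SmoothHolAt μ (fun p => ∫ t in a..b, Φ (p, t)) x₀ := by
  let T : Set ((E × Y) × ℝ) := {y | ContDiffAt ℝ μ Φ y ∧
      DifferentiableAt ℂ (fun Z => Φ ((Z, y.1.2), y.2)) y.1.1}
  let S : Set ((E × Y) × ℝ) := interior T
  have hS : IsOpen S := isOpen_interior
  have hS1 : ∀ y ∈ S, ContDiffAt ℝ μ Φ y ∧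
      DifferentiableAt ℂ (fun Z => Φ ((Z, y.1.2), y.2)) y.1.1 :=
    fun y hy => interior_subset (s := T) hy
  have hW := isOpen_setOf_forall_mem_of_isCompact hS (isCompact_uIcc (a := a) (b := b))
  have hΦS : ContDiffOn ℝ μ Φ S := fun y hy => (hS1 y hy).1.contDiffWithinAt
  have hI := hΦS.intervalIntegral hS (a := a) (b := b)
  filter_upwards [hW.mem_nhds fun t ht => mem_interior_iff_mem_nhds.2 (hΦ t ht)] with p hp
  refine ⟨hI.contDiffAt (hW.mem_nhds hp), ?_⟩
  let j : E × ℝ → (E × Y) × ℝ := fun z => ((z.1, p.2), z.2)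
  have hj : Continuous j := by fun_prop
  refine (hasFDerivAt_intervalIntegral_of_continuousOn (𝕜 := ℂ) (S := j ⁻¹' S) (a := a) (b := b)
    (Φ := fun z => Φ (j z)) (Φ' := fun z => fderiv ℂ (fun Z => Φ ((Z, p.2), z.2)) z.1)
    (hS.preimage hj) (hΦS.continuousOn.comp hj.continuousOn fun _ h => h) ?_ ?_
    (p₀ := p.1) hp).differentiableAt
  · have h1 : ContinuousOn (fun z => (fderiv ℝ Φ (j z)).comp
        ((ContinuousLinearMap.inl ℝ (E × Y) ℝ).comp (ContinuousLinearMap.inl ℝ E Y)))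
        (j ⁻¹' S) :=
      ((hΦS.continuousOn_fderiv_of_isOpen hS (mod_cast hμ)).comp hj.continuousOn
        fun _ h => h).clm_comp continuousOn_const
    have h2 := (ContinuousLinearMap.restrictScalarsIsometry ℂ E G ℝ ℝ).isometry.isEmbedding
    refine h2.continuousOn_iff.2 (h1.congr fun z hz => ?_)
    have h3 := (hS1 _ hz).2.hasFDerivAt.restrictScalars ℝ
    have h4 : HasFDerivAt Φ (fderiv ℝ Φ (j z)) ((z.1, p.2), z.2) :=
      ((hS1 _ hz).1.differentiableAt (by
        have : (μ : WithTop ℕ∞) ≠ 0 := by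
          have := lt_of_lt_of_le zero_lt_one hμ
          exact_mod_cast this.ne'
        exact this)).hasFDerivAt
    have h5 := h4.comp z.1 ((hasFDerivAt_prodMk_left (𝕜 := ℝ) (z.1, p.2) z.2).comp z.1
      (hasFDerivAt_prodMk_left (𝕜 := ℝ) z.1 p.2))
    exact h3.unique h5
  · exact fun z hz => (hS1 _ hz).2.hasFDerivAt

theorem fderiv_apply [CompleteSpace G] (hμ : 1 ≤ μ) {f : E × Y → G} (hf : SmoothHolAt μ f x₀)
    (v : E) : SmoothHolAt μ (fun p => fderiv ℂ (fun Z => f (Z, p.2)) p.1 v) x₀ := by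
  obtain ⟨δ, hδ, hgood⟩ := Metric.eventually_nhds_iff_ball.1 hf
  obtain ⟨r, hr, hrv⟩ : ∃ r : ℝ, 0 < r ∧ r * ‖v‖ < δ / 2 := by
    refine ⟨δ / 2 / (‖v‖ + 1), by positivity, ?_⟩
    rw [div_mul_eq_mul_div, div_lt_iff₀ (by positivity)]
    gcongr
    linarith
  let Φ : (E × Y) × ℝ → G := fun y => deriv (circleMap 0 r) y.2 •
    (1 / (circleMap 0 r y.2 - 0) ^ 2) • f (y.1.1 + circleMap 0 r y.2 • v, y.1.2)
  have hΦ : SmoothHolAt μ (fun p => ∫ θ in (0 : ℝ)..2 * Real.pi, Φ (p, θ)) x₀ := by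
    refine SmoothHolAt.intervalIntegral hμ fun θ _ => ?_
    have hc : Continuous fun y : (E × Y) × ℝ => (y.1.1 + circleMap 0 r y.2 • v, y.1.2) := by
      have := continuous_circleMap 0 r
      fun_prop
    have hmem : (0 + circleMap 0 r θ • v, x₀) ∈ ball ((0 : E), x₀) δ := by
      rw [mem_ball, Prod.dist_eq, max_lt_iff]
      simp only [zero_add, dist_zero_right, norm_smul, norm_circleMap_zero, abs_of_pos hr,
        dist_self]
      exact ⟨by linarith, hδ⟩
    filter_upwards [hc.continuousAt.preimage_mem_nhds (isOpen_ball.mem_nhds hmem)] with y hy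
    obtain ⟨h1, h2⟩ := hgood _ hy
    have hcm : ContDiff ℝ μ (fun y : (E × Y) × ℝ => circleMap 0 r y.2) :=
      (contDiff_circleMap 0 r).comp contDiff_snd
    constructor
    · refine ContDiffAt.smul ?_ (ContDiffAt.smul ?_ ?_)
      · simp only [deriv_circleMap]
        exact (hcm.mul contDiff_const).contDiffAt
      · simp only [one_div]
        refine ContDiffAt.inv (((hcm.sub contDiff_const).pow 2).contDiffAt) ?_
        simpa using circleMap_ne_center (c := 0) (θ := y.2) hr.ne'
      · refine ContDiffAt.comp (g := f)
          (f := fun y : (E × Y) × ℝ => (y.1.1 + circleMap 0 r y.2 • v, y.1.2)) y h1 ?_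
        exact ((contDiff_fst.fst.add (hcm.smul contDiff_const)).prodMk contDiff_fst.snd).contDiffAt
    · have h3 : DifferentiableAt ℂ (fun Z => f (Z + circleMap 0 r y.2 • v, y.1.2)) y.1.1 :=
        DifferentiableAt.comp (g := fun Z => f (Z, y.1.2))
          (f := fun Z : E => Z + circleMap 0 r y.2 • v) y.1.1 h2 (by fun_prop)
      exact (h3.fun_const_smul (1 / (circleMap 0 r y.2 - 0) ^ 2)).fun_const_smul
        (deriv (circleMap 0 r) y.2)
  refine (hΦ.clm_const ((2 * Real.pi * Complex.I : ℂ)⁻¹ • ContinuousLinearMap.id ℂ G)).congr ?_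
  filter_upwards [ball_mem_nhds ((0 : E), x₀) (half_pos hδ)] with p hp
  rw [mem_ball, Prod.dist_eq, max_lt_iff] at hp
  let φ : ℂ → G := fun ζ => f (p.1 + ζ • v, p.2)
  have hφd : ∀ ζ ∈ closedBall (0 : ℂ) r, DifferentiableAt ℂ φ ζ := by
    intro ζ hζ
    have hmem : (p.1 + ζ • v, p.2) ∈ ball ((0 : E), x₀) δ := by
      rw [mem_ball, Prod.dist_eq, max_lt_iff]
      refine ⟨?_, by simpa using hp.2.trans (half_lt_self hδ)⟩
      have h3 : ‖ζ‖ ≤ r := by simpa using hζ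
      have h4 : ‖p.1‖ < δ / 2 := by simpa using hp.1
      calc dist (p.1 + ζ • v) 0 ≤ ‖p.1‖ + ‖ζ‖ * ‖v‖ := by
            simpa [norm_smul] using norm_add_le p.1 (ζ • v)
        _ ≤ ‖p.1‖ + r * ‖v‖ := by gcongr
        _ < δ := by linarith
    exact DifferentiableAt.comp (g := fun Z => f (Z, p.2)) (f := fun ζ : ℂ => p.1 + ζ • v) ζ
      (hgood _ hmem).2 (by fun_prop)
  have h5 : DifferentiableAt ℂ (fun Z => f (Z, p.2)) p.1 := by
    refine (hgood p ?_).2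
    rw [mem_ball, Prod.dist_eq, max_lt_iff]
    exact ⟨hp.1.trans (half_lt_self hδ), hp.2.trans (half_lt_self hδ)⟩
  have h6 : deriv φ 0 = fderiv ℂ (fun Z => f (Z, p.2)) p.1 v := by
    have h7 : HasDerivAt (fun ζ : ℂ => p.1 + ζ • v) v 0 := by
      simpa using ((hasDerivAt_id (0 : ℂ)).smul_const v).const_add p.1
    have h8 : HasFDerivAt (fun Z => f (Z, p.2)) (fderiv ℂ (fun Z => f (Z, p.2)) p.1)
      (p.1 + (0 : ℂ) • v) := by simpa using h5.hasFDerivAt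
    exact (h8.comp_hasDerivAt 0 h7).deriv
  have h9 := DifferentiableOn.deriv_eq_smul_circleIntegral (c := 0) hr
    (fun ζ hζ => (hφd ζ hζ).differentiableWithinAt)
  have h10 : ∮ z in C(0, r), (1 / (z - 0) ^ 2) • φ z = ∫ θ in (0 : ℝ)..2 * Real.pi, Φ (p, θ) := rfl
  rw [← h6, ← h10, h9, smul_apply, ContinuousLinearMap.id_apply,
    inv_smul_smul₀ Complex.two_pi_I_ne_zero]

theorem fderiv [FiniteDimensional ℂ E] [CompleteSpace G] (hμ : 1 ≤ μ) {f : E × Y → G}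
    (hf : SmoothHolAt μ f x₀) :
    SmoothHolAt μ (fun p => fderiv ℂ (fun Z => f (Z, p.2)) p.1) x₀ := by
  let b := Module.finBasis ℂ E
  let β : Fin (Module.finrank ℂ E) → E →L[ℂ] ℂ :=
    fun i => LinearMap.toContinuousLinearMap (b.coord i)
  have h1 : SmoothHolAt μ (fun p => ∑ i, ContinuousLinearMap.smulRightL ℂ E G (β i)
      (_root_.fderiv ℂ (fun Z => f (Z, p.2)) p.1 (b i))) x₀ :=
    SmoothHolAt.sum _ fun i _ => (hf.fderiv_apply hμ (b i)).clm_const _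
  refine h1.congr (.of_forall fun p => ?_)
  ext v
  conv_lhs => rw [← b.sum_repr v]
  simp [β, map_sum, -Module.Basis.sum_repr]

theorem contDiffAt_slice [FiniteDimensional ℂ E] [CompleteSpace G] (hμ : 1 ≤ μ) {f : E × Y → G}
    (hf : SmoothHolAt μ f x₀) (n : ℕ) : ContDiffAt ℂ n (fun Z => f (Z, x₀)) 0 := by
  have hc : Tendsto (fun Z : E => (Z, x₀)) (𝓝 0) (𝓝 (0, x₀)) :=
    Continuous.tendsto (by fun_prop) 0
  induction n generalizing G with
  | zero =>
    refine contDiffAt_zero.2 ⟨_, hc.eventually hf, fun Z hZ => ?_⟩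
    exact hZ.2.continuousAt.continuousWithinAt
  | succ n ih =>
    refine contDiffAt_succ_iff_hasFDerivAt.2
      ⟨_, ⟨_, hc.eventually hf, fun Z hZ => hZ.2.hasFDerivAt⟩, ih (hf.fderiv hμ)⟩

end SmoothHolAt

end SmoothHol

section Holomorphic

theorem intervalIntegral_isLittleO {E F G : Type*} [NormedAddCommGroup E]
    [NormedAddCommGroup F] [NormedAddCommGroup G] [NormedSpace ℝ G] {ω : E → F} {Ψ : E → ℝ → G}
    {σ : ℝ → E → E} {C D : ℝ} {r : ℕ}
    (hω : ω =o[𝓝 0] fun Z => ‖Z‖ ^ r) (hC : 0 ≤ C) (hD : 0 ≤ D)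
    (hσ : ∀ t ∈ Ioc (0 : ℝ) 1, ∀ Z, ‖σ t Z‖ ≤ C * ‖Z‖)
    (hΨ : ∀ t ∈ Ioc (0 : ℝ) 1, ∀ Z, ‖Ψ Z t‖ ≤ ‖ω (σ t Z)‖ * (D * ‖Z‖)) :
    (fun Z => ∫ t in (0 : ℝ)..1, Ψ Z t) =o[𝓝 0] fun Z => ‖Z‖ ^ (r + 1) := by
  refine isLittleO_iff.2 fun ε hε => ?_
  have hε' : 0 < ε / ((C + 1) ^ r * (D + 1)) := by positivity
  obtain ⟨δ, hδ, hδω⟩ := Metric.eventually_nhds_iff_ball.1 (isLittleO_iff.1 hω hε')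
  filter_upwards [ball_mem_nhds (0 : E) (show 0 < δ / (C + 1) by positivity)] with Z hZ
  have hZδ : ‖Z‖ * (C + 1) < δ := (lt_div_iff₀ (by positivity)).1 (by simpa using hZ)
  have hb : ∀ t ∈ uIoc (0 : ℝ) 1, ‖Ψ Z t‖ ≤ ε * ‖Z‖ ^ (r + 1) := by
    intro t ht
    rw [uIoc_of_le zero_le_one] at ht
    have h1 : ‖σ t Z‖ ≤ (C + 1) * ‖Z‖ := by nlinarith [hσ t ht Z, norm_nonneg Z]
    have h2 := hδω (σ t Z) (by rw [mem_ball_zero_iff]; linarith)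
    rw [norm_pow, norm_norm] at h2
    calc ‖Ψ Z t‖ ≤ ‖ω (σ t Z)‖ * (D * ‖Z‖) := hΨ t ht Z
      _ ≤ (ε / ((C + 1) ^ r * (D + 1)) * ((C + 1) * ‖Z‖) ^ r) * ((D + 1) * ‖Z‖) := by
        gcongr
        · exact h2.trans (by gcongr)
        · linarith
      _ = ε * ‖Z‖ ^ (r + 1) := by
        rw [mul_pow]
        field_simp
        ring
  simpa using intervalIntegral.norm_integral_le_of_norm_le_const hb

variable {E G K : Type u} [NormedAddCommGroup E] [NormedSpace ℂ E] [NormedAddCommGroup G]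
  [NormedSpace ℂ G] [NormedAddCommGroup K] [NormedSpace ℂ K]

theorem norm_mul_norm_fderiv_isLittleO {g : E → G} {r : ℕ}
    (hd : ∀ᶠ Z in 𝓝 0, DifferentiableAt ℂ g Z) (hg : g =o[𝓝 0] fun Z => ‖Z‖ ^ r) :
    (fun Z => ‖Z‖ * ‖fderiv ℂ g Z‖) =o[𝓝 0] fun Z => ‖Z‖ ^ r := by
  refine isLittleO_iff.2 fun ε hε => ?_
  have hε' : 0 < ε / 2 ^ r := by positivity
  obtain ⟨δ, hδ, hδg⟩ := Metric.eventually_nhds_iff_ball.1 (hd.and (isLittleO_iff.1 hg hε'))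
  filter_upwards [ball_mem_nhds (0 : E) (half_pos hδ)] with Z hZ
  have hZδ : ‖Z‖ < δ / 2 := by simpa using hZ
  rw [norm_mul, norm_norm, norm_norm, norm_pow, norm_norm]
  rcases eq_or_ne Z 0 with rfl | hZ0
  · simp only [norm_zero, zero_mul]
    positivity
  have hZpos : 0 < ‖Z‖ := norm_pos_iff.2 hZ0
  rw [mul_comm, ← le_div_iff₀ hZpos]
  refine ContinuousLinearMap.opNorm_le_bound _ (by positivity) fun v => ?_
  rcases eq_or_ne v 0 with rfl | hv0
  · simp
  have hvpos : 0 < ‖v‖ := norm_pos_iff.2 hv0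
  have hR : 0 < ‖Z‖ / ‖v‖ := by positivity
  have hmem : ∀ ζ ∈ closedBall (0 : ℂ) (‖Z‖ / ‖v‖), ‖Z + ζ • v‖ ≤ 2 * ‖Z‖ := by
    intro ζ hζ
    have h1 : ‖ζ‖ * ‖v‖ ≤ ‖Z‖ := (le_div_iff₀ hvpos).1 (by simpa using hζ)
    calc ‖Z + ζ • v‖ ≤ ‖Z‖ + ‖ζ‖ * ‖v‖ := by simpa [norm_smul] using norm_add_le Z (ζ • v)
      _ ≤ 2 * ‖Z‖ := by linarith
  have hball : ∀ ζ ∈ closedBall (0 : ℂ) (‖Z‖ / ‖v‖), Z + ζ • v ∈ ball (0 : E) δ := by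
    intro ζ hζ
    rw [mem_ball_zero_iff]
    linarith [hmem ζ hζ]
  have hderiv : HasDerivAt (fun ζ : ℂ => g (Z + ζ • v)) (fderiv ℂ g Z v) 0 := by
    have h7 : HasDerivAt (fun ζ : ℂ => Z + ζ • v) v 0 := by
      simpa using ((hasDerivAt_id (0 : ℂ)).smul_const v).const_add Z
    have h8 : HasFDerivAt g (fderiv ℂ g Z) (Z + (0 : ℂ) • v) := by
      have := (hδg Z (by rw [mem_ball_zero_iff]; linarith)).1.hasFDerivAt
      simpa using this
    exact h8.comp_hasDerivAt 0 h7
  rw [← hderiv.deriv]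
  refine (Complex.norm_deriv_le_of_forall_mem_sphere_norm_le hR
    (C := ε / 2 ^ r * (2 * ‖Z‖) ^ r) (DifferentiableOn.diffContOnCl fun ζ hζ => ?_)
    fun ζ hζ => ?_).trans_eq ?_
  · rw [closure_ball _ hR.ne'] at hζ
    exact (DifferentiableAt.comp (g := g) (f := fun ζ : ℂ => Z + ζ • v) ζ (hδg _ (hball ζ hζ)).1
      (by fun_prop)).differentiableWithinAt
  · have h2 := (hδg _ (hball ζ (sphere_subset_closedBall hζ))).2
    rw [norm_pow, norm_norm] at h2
    refine h2.trans ?_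
    gcongr
    exact hmem ζ (sphere_subset_closedBall hζ)
  · rw [mul_pow]
    field_simp

/-- The skew part `(ξ, η) ↦ A ξ η - A η ξ` of a bilinear map. -/
noncomputable def skewPart (A : K →L[ℂ] K →L[ℂ] G) : K →L[ℂ] K →L[ℂ] G := A - A.flip

theorem skewPart_apply (A : K →L[ℂ] K →L[ℂ] G) (ξ η : K) :
    skewPart A ξ η = A ξ η - A η ξ := rfl

theorem norm_skewPart_le (A : K →L[ℂ] K →L[ℂ] G) : ‖skewPart A‖ ≤ 2 * ‖A‖ := by
  calc ‖A - A.flip‖ ≤ ‖A‖ + ‖A.flip‖ := norm_sub_le A A.flip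
    _ = 2 * ‖A‖ := by rw [ContinuousLinearMap.opNorm_flip, two_mul]

/-- The map `Z ↦ Z - (1 - t) v (Λ Z)`, which contracts the range of `v` when `Λ ∘ v = id`. -/
noncomputable def contractAlong (v : K →L[ℂ] E) (Λ : E →L[ℂ] K) (t : ℝ) : E →L[ℂ] E :=
  .id ℂ E - (1 - t) • v.comp Λ

theorem contractAlong_apply (v : K →L[ℂ] E) (Λ : E →L[ℂ] K) (t : ℝ) (Z : E) :
    contractAlong v Λ t Z = Z - (1 - t) • v (Λ Z) := rfl

theorem continuous_contractAlong (v : K →L[ℂ] E) (Λ : E →L[ℂ] K) :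
    Continuous (contractAlong v Λ) := by
  unfold contractAlong
  fun_prop

theorem norm_contractAlong_apply_le (v : K →L[ℂ] E) (Λ : E →L[ℂ] K) {t : ℝ}
    (ht : t ∈ Ioc (0 : ℝ) 1) (Z : E) : ‖contractAlong v Λ t Z‖ ≤ (1 + ‖v‖ * ‖Λ‖) * ‖Z‖ := by
  have h1 : ‖1 - t‖ ≤ 1 := by
    rw [Real.norm_eq_abs, abs_le]
    constructor <;> linarith [ht.1, ht.2]
  calc ‖contractAlong v Λ t Z‖ ≤ ‖Z‖ + ‖1 - t‖ * ‖v (Λ Z)‖ := by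
        rw [contractAlong_apply, ← norm_smul]
        exact norm_sub_le _ _
    _ ≤ ‖Z‖ + 1 * (‖v‖ * (‖Λ‖ * ‖Z‖)) := by
        gcongr
        exact (v.le_opNorm _).trans (by gcongr; exact Λ.le_opNorm _)
    _ = _ := by ring

/-- The homotopy operator of the Poincaré lemma in the directions of the range of `v`. -/
noncomputable def leafPrimitive (v : K →L[ℂ] E) (Λ : E →L[ℂ] K) (g : E → K →L[ℂ] G) (Z : E) : G :=
  ∫ t in (0 : ℝ)..1, g (contractAlong v Λ t Z) (Λ Z)

theorem leafPrimitive_isLittleO (v : K →L[ℂ] E) (Λ : E →L[ℂ] K) {g : E → K →L[ℂ] G} {r : ℕ}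
    (hg : g =o[𝓝 0] fun Z => ‖Z‖ ^ r) :
    leafPrimitive v Λ g =o[𝓝 0] fun Z => ‖Z‖ ^ (r + 1) :=
  intervalIntegral_isLittleO hg (by positivity) (norm_nonneg Λ)
    (fun _ ht Z => norm_contractAlong_apply_le v Λ ht Z)
    fun _ _ Z => (ContinuousLinearMap.le_opNorm _ _).trans (by gcongr; exact Λ.le_opNorm _)

theorem eventually_hasFDerivAt_leafPrimitive [CompleteSpace G] {v : K →L[ℂ] E} {Λ : E →L[ℂ] K}
    (hΛv : ∀ ξ, Λ (v ξ) = ξ) {g : E → K →L[ℂ] G} (hg : ContDiffAt ℂ 1 g 0) :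
    ∀ᶠ Z in 𝓝 0, DifferentiableAt ℂ (leafPrimitive v Λ g) Z ∧
      (fderiv ℂ (leafPrimitive v Λ g) Z).comp v = g Z - ∫ t in (0 : ℝ)..1,
        t • skewPart ((fderiv ℂ g (contractAlong v Λ t Z)).comp v) (Λ Z) := by
  obtain ⟨Ω', hΩ', hgΩ'⟩ := hg.contDiffOn le_rfl (by simp)
  obtain ⟨Ω, hΩΩ', hΩ, hΩ0⟩ := _root_.mem_nhds_iff.1 hΩ'
  have hgΩ : ContDiffOn ℂ 1 g Ω := hgΩ'.mono hΩΩ'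
  have hdg : ∀ Z ∈ Ω, HasFDerivAt g (fderiv ℂ g Z) Z := fun Z hZ =>
    ((hgΩ.differentiableOn one_ne_zero).differentiableAt (hΩ.mem_nhds hZ)).hasFDerivAt
  have hσ : Continuous fun z : E × ℝ => contractAlong v Λ z.2 z.1 :=
    ((continuous_contractAlong v Λ).comp continuous_snd).clm_apply continuous_fst
  let S : Set (E × ℝ) := (fun z : E × ℝ => contractAlong v Λ z.2 z.1) ⁻¹' Ω
  have hS : IsOpen S := hΩ.preimage hσ
  have hgS : ContinuousOn (fun z : E × ℝ => g (contractAlong v Λ z.2 z.1)) S :=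
    hgΩ.continuousOn.comp hσ.continuousOn fun _ h => h
  have hdgS : ContinuousOn (fun z : E × ℝ => fderiv ℂ g (contractAlong v Λ z.2 z.1)) S :=
    (hgΩ.continuousOn_fderiv_of_isOpen hΩ le_rfl).comp hσ.continuousOn fun _ h => h
  let Φ : E × ℝ → G := fun z => g (contractAlong v Λ z.2 z.1) (Λ z.1)
  let Φ' : E × ℝ → E →L[ℂ] G := fun z =>
    (g (contractAlong v Λ z.2 z.1)).comp Λ +
      ((fderiv ℂ g (contractAlong v Λ z.2 z.1)).comp (contractAlong v Λ z.2)).flip (Λ z.1)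
  have hσ2 : Continuous fun z : E × ℝ => contractAlong v Λ z.2 :=
    (continuous_contractAlong v Λ).comp continuous_snd
  have hΛ1 : Continuous fun z : E × ℝ => Λ z.1 := by fun_prop
  have hΦ : ContinuousOn Φ S := hgS.clm_apply hΛ1.continuousOn
  have hΦ' : ContinuousOn Φ' S := by
    refine (hgS.clm_comp continuousOn_const).add ?_
    have h1 := hdgS.clm_comp hσ2.continuousOn
    exact ((ContinuousLinearMap.flipₗᵢ ℂ E K G).continuous.comp_continuousOn h1).clm_apply
      hΛ1.continuousOn
  have hd : ∀ z ∈ S, HasFDerivAt (fun p => Φ (p, z.2)) (Φ' z) z.1 := by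
    intro z hz
    have h1 := (hdg _ hz).comp z.1 (contractAlong v Λ z.2).hasFDerivAt
    exact h1.clm_apply Λ.hasFDerivAt
  have hW := isOpen_setOf_forall_mem_of_isCompact hS (isCompact_uIcc (a := (0 : ℝ)) (b := 1))
  filter_upwards [hW.mem_nhds fun t _ => by simpa [S] using hΩ0] with Z hZ
  have hH : HasFDerivAt (leafPrimitive v Λ g) (∫ t in (0 : ℝ)..1, Φ' (Z, t)) Z :=
    hasFDerivAt_intervalIntegral_of_continuousOn hS hΦ hΦ' hd hZ
  refine ⟨hH.differentiableAt, ?_⟩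
  rw [hH.fderiv]
  have hslice {T : Type u} [TopologicalSpace T] {Ψ : E × ℝ → T} (hΨ : ContinuousOn Ψ S) :
      ContinuousOn (fun t => Ψ (Z, t)) (uIcc 0 1) := hΨ.prodMk_right_of_forall_mem hZ
  have h1 : (∫ t in (0 : ℝ)..1, Φ' (Z, t)).comp v = ∫ t in (0 : ℝ)..1, (Φ' (Z, t)).comp v :=
    (((ContinuousLinearMap.compL ℂ K E G).flip v).intervalIntegral_comp_comm
      (hslice hΦ').intervalIntegrable).symm
  let D : ℝ → K →L[ℂ] G := fun t => g (contractAlong v Λ t Z) +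
    t • fderiv ℂ g (contractAlong v Λ t Z) (v (Λ Z))
  have hDc : ContinuousOn D (uIcc 0 1) :=
    (hslice hgS).add (continuousOn_id.smul ((hslice hdgS).clm_apply continuousOn_const))
  have hsk : ContinuousOn (fun t : ℝ =>
      t • skewPart ((fderiv ℂ g (contractAlong v Λ t Z)).comp v) (Λ Z)) (uIcc 0 1) := by
    have h2 : ContinuousOn (fun t : ℝ => (fderiv ℂ g (contractAlong v Λ t Z)).comp v)
      (uIcc 0 1) := (hslice hdgS).clm_comp continuousOn_const
    exact continuousOn_id.smul ((h2.sub ((ContinuousLinearMap.flipₗᵢ ℂ K K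
      G).continuous.comp_continuousOn h2)).clm_apply continuousOn_const)
  have h2 : ∀ t, (Φ' (Z, t)).comp v =
      D t - t • skewPart ((fderiv ℂ g (contractAlong v Λ t Z)).comp v) (Λ Z) := by
    intro t
    ext ξ
    have h3 : contractAlong v Λ t (v ξ) = t • v ξ := by
      rw [contractAlong_apply, hΛv, sub_smul, one_smul, sub_sub_cancel]
    simp only [Φ', D, ContinuousLinearMap.comp_apply, add_apply,
      sub_apply, smul_apply, skewPart_apply,
      ContinuousLinearMap.flip_apply, hΛv, h3, ContinuousLinearMap.map_smul_of_tower]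
    rw [smul_sub]
    abel
  have h3 : ∫ t in (0 : ℝ)..1, D t = g Z := by
    have h4 : ∀ t ∈ uIcc (0 : ℝ) 1,
        HasDerivAt (fun t : ℝ => t • g (contractAlong v Λ t Z)) (D t) t := by
      intro t ht
      have h5 : HasDerivAt (fun t : ℝ => contractAlong v Λ t Z) (v (Λ Z)) t := by
        simp only [contractAlong_apply]
        simpa using (((hasDerivAt_id t).const_sub 1).smul_const (v (Λ Z))).const_sub Z
      have h6 := ((hdg _ (hZ t ht)).restrictScalars ℝ).comp_hasDerivAt t h5
      have h7 := (hasDerivAt_id t).smul h6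
      exact h7.congr_deriv (by simp [D, add_comm])
    rw [intervalIntegral.integral_eq_sub_of_hasDerivAt h4 hDc.intervalIntegrable]
    simp [contractAlong_apply]
  rw [h1, ← h3, ← intervalIntegral.integral_sub hDc.intervalIntegrable hsk.intervalIntegrable]
  simp only [h2]

end Holomorphic

section FrobeniusStep

variable {E G K : Type u} [NormedAddCommGroup E] [NormedSpace ℂ E] [NormedAddCommGroup G]
  [NormedSpace ℂ G] [NormedAddCommGroup K] [NormedSpace ℂ K]

theorem skewPart_fderiv_comp_comp {F : E → G} {A : E → K →L[ℂ] E} {Z : E} (J : K →L[ℂ] G)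
    (hF : ContDiffAt ℂ 2 F Z) (hA : DifferentiableAt ℂ A Z) :
    skewPart ((fderiv ℂ (fun W => (fderiv ℂ F W).comp (A W) - J) Z).comp (A Z)) =
      (ContinuousLinearMap.compL ℂ K E G (fderiv ℂ F Z)).comp
        (skewPart ((fderiv ℂ A Z).comp (A Z))) := by
  have hsymm : IsSymmSndFDerivAt ℂ F Z := hF.isSymmSndFDerivAt (by simp)
  have h1 : HasFDerivAt (fderiv ℂ F) (fderiv ℂ (fderiv ℂ F) Z) Z :=
    ((hF.fderiv_right (m := 1) (by norm_num)).differentiableAt one_ne_zero).hasFDerivAt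
  rw [((h1.clm_comp hA.hasFDerivAt).sub_const J).fderiv]
  ext ξ η
  simp [skewPart_apply, hsymm.eq (A Z ξ) (A Z η)]

theorem skewPart_sub (A B : K →L[ℂ] K →L[ℂ] G) : skewPart (A - B) = skewPart A - skewPart B := by
  ext ξ η
  simp only [skewPart_apply, sub_apply]
  abel

theorem fderiv_sub_leafPrimitive_isLittleO [CompleteSpace G] {A : E → K →L[ℂ] E} {F : E → G}
    {Λ : E →L[ℂ] K} {J : K →L[ℂ] G} {r k : ℕ} (hr : r ≤ k) (hA : ContDiffAt ℂ 1 A 0)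
    (hF : ContDiffAt ℂ 2 F 0) (hΛ : ∀ ξ, Λ (A 0 ξ) = ξ)
    (hB : (fun Z => skewPart ((fderiv ℂ A Z).comp (A Z))) =o[𝓝 0] fun Z => ‖Z‖ ^ k)
    (hg : (fun Z => (fderiv ℂ F Z).comp (A Z) - J) =o[𝓝 0] fun Z => ‖Z‖ ^ r) :
    (fun Z => (fderiv ℂ (fun W => F W - leafPrimitive (A 0) Λ
      (fun Z => (fderiv ℂ F Z).comp (A Z) - J) W) Z).comp (A Z) - J) =o[𝓝 0]
        fun Z => ‖Z‖ ^ (r + 1) := by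
  set g : E → K →L[ℂ] G := fun Z => (fderiv ℂ F Z).comp (A Z) - J with hgdef
  have hDF : ContDiffAt ℂ 1 (fderiv ℂ F) 0 := hF.fderiv_right (by norm_num)
  have hgc : ContDiffAt ℂ 1 g 0 := (hDF.clm_comp hA).sub contDiffAt_const
  have hev {T : Type u} [NormedAddCommGroup T] [NormedSpace ℂ T] {f : E → T}
      (hf : ContDiffAt ℂ 1 f 0) : ∀ᶠ Z in 𝓝 0, DifferentiableAt ℂ f Z :=
    (hf.eventually (by simp)).mono fun Z hZ => hZ.differentiableAt one_ne_zero
  have hb : (fun Z => A Z - A 0) =O[𝓝 0] fun Z => ‖Z‖ := by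
    simpa using (hA.differentiableAt one_ne_zero).isBigO_sub.norm_right
  have hmul {T : Type u} [NormedAddCommGroup T] [NormedSpace ℂ T] {f : E → T} {s : ℕ}
      (hd : ∀ᶠ Z in 𝓝 0, DifferentiableAt ℂ f Z) (hf : f =o[𝓝 0] fun Z => ‖Z‖ ^ s) :
      (fun Z => ((fderiv ℂ f Z).comp (A Z - A 0))) =o[𝓝 0] fun Z => ‖Z‖ ^ s := by
    refine IsBigO.trans_isLittleO ?_ (norm_mul_norm_fderiv_isLittleO hd hf)
    have h1 : (fun Z => ((fderiv ℂ f Z).comp (A Z - A 0))) =O[𝓝 0]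
        fun Z => ‖A Z - A 0‖ * ‖fderiv ℂ f Z‖ :=
      .of_norm_le fun Z => by
        rw [mul_comm]
        exact ContinuousLinearMap.opNorm_comp_le _ _
    exact h1.trans (hb.norm_left.mul (isBigO_refl _ _))
  have hω : (fun Z => skewPart ((fderiv ℂ g Z).comp (A 0))) =o[𝓝 0] fun Z => ‖Z‖ ^ r := by
    have h1 : (fun Z => skewPart ((fderiv ℂ g Z).comp (A Z))) =o[𝓝 0] fun Z => ‖Z‖ ^ r := by
      have h2 : (fun Z => ‖fderiv ℂ F Z‖ * ‖skewPart ((fderiv ℂ A Z).comp (A Z))‖) =o[𝓝 0]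
          fun Z : E => (1 : ℝ) * ‖Z‖ ^ k :=
        (hDF.continuousAt.isBigO_one ℝ).norm_left.mul_isLittleO
          (IsLittleO.norm_left (E' := K →L[ℂ] K →L[ℂ] E) hB)
      have h3 : (fun Z : E => (1 : ℝ) * ‖Z‖ ^ k) =O[𝓝 0] fun Z => ‖Z‖ ^ r := by
        simp only [one_mul]
        refine IsBigO.of_bound 1 ?_
        filter_upwards [ball_mem_nhds (0 : E) one_pos] with Z hZ
        have hZ1 : ‖Z‖ < 1 := by simpa using hZ
        simpa using pow_le_pow_of_le_one (norm_nonneg Z) hZ1.le hr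
      refine IsBigO.trans_isLittleO ?_ (h2.trans_isBigO h3)
      refine IsBigO.of_norm_eventuallyLE ?_
      filter_upwards [hev hA, hF.eventually (by simp)] with Z hAZ hFZ
      rw [skewPart_fderiv_comp_comp J hFZ hAZ]
      refine (ContinuousLinearMap.opNorm_comp_le _ _).trans ?_
      gcongr
      exact ContinuousLinearMap.opNorm_le_bound _ (norm_nonneg _) fun u =>
        ContinuousLinearMap.opNorm_comp_le _ _
    have h4 : (fun Z => skewPart ((fderiv ℂ g Z).comp (A Z - A 0))) =o[𝓝 0]
        fun Z => ‖Z‖ ^ r :=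
      IsBigO.trans_isLittleO (.of_bound 2 (.of_forall fun Z => norm_skewPart_le _))
        (hmul (hev hgc) hg)
    refine (IsLittleO.sub (E' := K →L[ℂ] K →L[ℂ] G) h1 h4).congr_left fun Z => ?_
    rw [← skewPart_sub, ← ContinuousLinearMap.comp_sub, sub_sub_cancel]
  have hI := intervalIntegral_isLittleO
    (ω := fun Z => skewPart ((fderiv ℂ g Z).comp (A 0)))
    (Ψ := fun Z t => t • skewPart ((fderiv ℂ g (contractAlong (A 0) Λ t Z)).comp (A 0)) (Λ Z))
    (σ := fun t => contractAlong (A 0) Λ t) hω (C := 1 + ‖A 0‖ * ‖Λ‖) (by positivity)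
    (norm_nonneg Λ) (fun _ ht Z => norm_contractAlong_apply_le (A 0) Λ ht Z)
    fun t ht Z => by
      rw [norm_smul, Real.norm_eq_abs, abs_of_pos ht.1]
      refine (mul_le_of_le_one_left (norm_nonneg _) ht.2).trans ?_
      exact (ContinuousLinearMap.le_opNorm _ _).trans (by gcongr; exact Λ.le_opNorm _)
  have hHev := eventually_hasFDerivAt_leafPrimitive hΛ hgc
  have hH := hmul (hHev.mono fun Z hZ => hZ.1) (leafPrimitive_isLittleO (A 0) Λ hg)
  refine (hI.sub hH).congr' ?_ .rfl
  filter_upwards [hHev, hF.eventually (by simp)] with Z hZ hFZ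
  have h5 : fderiv ℂ (fun W => F W - leafPrimitive (A 0) Λ g W) Z =
      fderiv ℂ F Z - fderiv ℂ (leafPrimitive (A 0) Λ g) Z :=
    fderiv_fun_sub (hFZ.differentiableAt two_ne_zero) hZ.1
  rw [h5, ContinuousLinearMap.comp_sub, hZ.2, ContinuousLinearMap.sub_comp]
  simp only [hgdef]
  abel

end FrobeniusStep

section ParametricRectification

variable {E Y G K : Type u} [NormedAddCommGroup E] [NormedSpace ℂ E] [NormedAddCommGroup Y]
  [NormedSpace ℝ Y] [NormedAddCommGroup G] [NormedSpace ℂ G] [NormedAddCommGroup K]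
  [NormedSpace ℂ K] {μ : ℕ∞} {x₀ : Y}

theorem ContDiffAt.clm_apply_restrictScalars {H : Type u} [NormedAddCommGroup H] [NormedSpace ℝ H]
    {A : H → K →L[ℂ] G} {f : H → K} {y : H} (hA : ContDiffAt ℝ μ A y) (hf : ContDiffAt ℝ μ f y) :
    ContDiffAt ℝ μ (fun z => A z (f z)) y := by
  have h : ContDiff ℂ μ fun z : (K →L[ℂ] G) × K => z.1 z.2 := by fun_prop
  exact (h.restrict_scalars ℝ).contDiffAt.comp y (hA.prodMk hf)

theorem SmoothHolAt.leafPrimitive [CompleteSpace G] (hμ : 1 ≤ μ) {A : E × Y → K →L[ℂ] E}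
    {g : E × Y → K →L[ℂ] G} (Λ : E →L[ℂ] K) (hA : SmoothHolAt μ A x₀) (hg : SmoothHolAt μ g x₀) :
    SmoothHolAt μ
      (fun p => _root_.leafPrimitive (A (0, p.2)) Λ (fun Z => g (Z, p.2)) p.1) x₀ := by
  refine SmoothHolAt.intervalIntegral hμ (Φ := fun y =>
    g (contractAlong (A (0, y.1.2)) Λ y.2 y.1.1, y.1.2) (Λ y.1.1)) fun t _ => ?_
  have hx : Tendsto (fun y : (E × Y) × ℝ => ((0 : E), y.1.2)) (𝓝 ((0, x₀), t)) (𝓝 (0, x₀)) :=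
    Continuous.tendsto (by fun_prop) ((0, x₀), t)
  have hσ : ∀ y : (E × Y) × ℝ, ContDiffAt ℝ μ A (0, y.1.2) → ContDiffAt ℝ μ
      (fun y : (E × Y) × ℝ => (contractAlong (A (0, y.1.2)) Λ y.2 y.1.1, y.1.2)) y := by
    intro y hy
    have h1 : ContDiffAt ℝ μ (fun y : (E × Y) × ℝ => A (0, y.1.2)) y :=
      ContDiffAt.comp (g := A) (f := fun y : (E × Y) × ℝ => ((0 : E), y.1.2)) y hy (by fun_prop)
    have h2 : ContDiffAt ℝ μ (fun y : (E × Y) × ℝ => Λ y.1.1) y :=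
      (Λ.restrictScalars ℝ).contDiff.contDiffAt.comp y (by fun_prop)
    have h3 := h1.clm_apply_restrictScalars h2
    have h4 : ContDiffAt ℝ μ (fun y : (E × Y) × ℝ => (1 - y.2) • A (0, y.1.2) (Λ y.1.1)) y :=
      (contDiffAt_const.sub contDiffAt_snd).smul h3
    have h5 : ContDiffAt ℝ μ (fun y : (E × Y) × ℝ => y.1.1) y := by fun_prop
    exact (h5.sub h4).prodMk (by fun_prop)
  have hlim : Tendsto (fun y : (E × Y) × ℝ => (contractAlong (A (0, y.1.2)) Λ y.2 y.1.1, y.1.2))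
      (𝓝 ((0, x₀), t)) (𝓝 (0, x₀)) := by
    have := (hσ ((0, x₀), t) hA.contDiffAt).continuousAt.tendsto
    simpa using this
  filter_upwards [hx.eventually hA, hlim.eventually hg] with y hyA hyg
  constructor
  · have h4 := ContDiffAt.comp y hyg.1 (hσ y hyA.1)
    exact h4.clm_apply_restrictScalars
      ((Λ.restrictScalars ℝ).contDiff.contDiffAt.comp y (by fun_prop))
  · have h5 := hyg.2.comp y.1.1 (contractAlong (A (0, y.1.2)) Λ y.2).differentiableAt
    exact h5.clm_apply Λ.differentiableAt

theorem exists_fderiv_comp_sub_isLittleO [FiniteDimensional ℂ E] [CompleteSpace G] (hμ : 1 ≤ μ)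
    {A : E × Y → K →L[ℂ] E} (hA : SmoothHolAt μ A x₀) {Λ : E →L[ℂ] K} {T : E →L[ℂ] G}
    {J : K →L[ℂ] G} {k : ℕ} (hΛ : ∀ᶠ x in 𝓝 x₀, ∀ ξ, Λ (A (0, x) ξ) = ξ)
    (hT : T.comp (A (0, x₀)) = J)
    (hB : ∀ᶠ x in 𝓝 x₀, (fun Z => skewPart ((fderiv ℂ (fun W => A (W, x)) Z).comp (A (Z, x))))
      =o[𝓝 0] fun Z => ‖Z‖ ^ k) (N : ℕ) (hN : N ≤ k + 1) :
    ∃ F : E × Y → G, SmoothHolAt μ F x₀ ∧ (∀ x, F (0, x) = 0) ∧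
      fderiv ℂ (fun Z => F (Z, x₀)) 0 = T ∧
      ∀ᶠ x in 𝓝 x₀, (fun Z => (fderiv ℂ (fun W => F (W, x)) Z).comp (A (Z, x)) - J)
        =o[𝓝 0] fun Z => ‖Z‖ ^ N := by
  induction N with
  | zero =>
    refine ⟨fun p => (T + (J - T.comp (A (0, p.2))).comp Λ) p.1, ?_, fun x => map_zero _, ?_, ?_⟩
    · exact ((SmoothHolAt.const T).add (((SmoothHolAt.const J).sub
        ((SmoothHolAt.const T).clm_comp hA.at_zero)).clm_comp (.const Λ))).clm_apply .fst
    · simp only [hT]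
      rw [sub_self, ContinuousLinearMap.zero_comp, add_zero]
      exact T.fderiv
    · filter_upwards [hΛ, hA.eventually] with x hx hAx
      have h1 : ContinuousAt (fun Z : E =>
          (T + (J - T.comp (A (0, x))).comp Λ).comp (A (Z, x)) - J) 0 := by
        have h2 : ContinuousAt (fun Z => A (Z, x)) 0 := (hAx.contDiffAt_slice hμ 0).continuousAt
        exact (continuousAt_const.clm_comp h2).sub continuousAt_const
      simp only [ContinuousLinearMap.fderiv, pow_zero]
      have h3 : (T + (J - T.comp (A (0, x))).comp Λ).comp (A (0, x)) - J = 0 := by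
        ext ξ
        simp [hx]
      rw [isLittleO_one_iff, ← h3]
      exact h1.tendsto
  | succ N ih =>
    obtain ⟨F, hF, hF0, hFT, hFo⟩ := ih (by omega)
    have hg : SmoothHolAt μ
        (fun p => (fderiv ℂ (fun W => F (W, p.2)) p.1).comp (A p) - J) x₀ :=
      ((hF.fderiv hμ).clm_comp hA).sub (.const J)
    refine ⟨fun p => F p - leafPrimitive (A (0, p.2)) Λ (fun Z =>
      (fderiv ℂ (fun W => F (W, p.2)) Z).comp (A (Z, p.2)) - J) p.1,
      hF.sub (hA.leafPrimitive hμ Λ hg), fun x => ?_, ?_, ?_⟩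
    · simp [hF0, leafPrimitive]
    · have h1 := leafPrimitive_isLittleO (A (0, x₀)) Λ hFo.self_of_nhds
      have h2 : (fun Z : E => ‖Z‖ ^ (N + 1)) =O[𝓝 0] fun Z => Z := by
        refine IsBigO.of_bound 1 ?_
        filter_upwards [ball_mem_nhds (0 : E) one_pos] with Z hZ
        have hZ1 : ‖Z‖ < 1 := by simpa using hZ
        simpa using pow_le_of_le_one (norm_nonneg Z) hZ1.le N.succ_ne_zero
      have h3 : HasFDerivAt (leafPrimitive (A (0, x₀)) Λ fun Z =>
          (fderiv ℂ (fun W => F (W, x₀)) Z).comp (A (Z, x₀)) - J) (0 : E →L[ℂ] G) 0 := by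
        have h4 : leafPrimitive (A (0, x₀)) Λ (fun Z =>
          (fderiv ℂ (fun W => F (W, x₀)) Z).comp (A (Z, x₀)) - J) 0 = 0 := by simp [leafPrimitive]
        rw [hasFDerivAt_iff_isLittleO_nhds_zero]
        simpa only [zero_add, h4, sub_zero, zero_apply] using h1.trans_isBigO h2
      have h4 := (hF.self_of_nhds.2.hasFDerivAt.sub h3).fderiv
      rw [sub_zero] at h4
      exact h4.trans hFT
    · filter_upwards [hFo, hΛ, hB, hF.eventually, hA.eventually] with x hx hΛx hBx hFx hAx
      have hA1 : ContDiffAt ℂ 1 (fun Z => A (Z, x)) 0 := mod_cast hAx.contDiffAt_slice hμ 1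
      have hF2 : ContDiffAt ℂ 2 (fun Z => F (Z, x)) 0 := mod_cast hFx.contDiffAt_slice hμ 2
      exact fderiv_sub_leafPrimitive_isLittleO (A := fun Z => A (Z, x)) (F := fun Z => F (Z, x))
        (Nat.succ_le_succ_iff.1 hN) hA1 hF2 hΛx hBx hx

end ParametricRectification

section Frames

variable {E G K : Type u} [NormedAddCommGroup E] [NormedSpace ℂ E] [NormedAddCommGroup G]
  [NormedSpace ℂ G] [NormedAddCommGroup K] [NormedSpace ℂ K]

theorem skewPart_fderiv_reframe_apply {A : E → K →L[ℂ] E} {h : E → K →L[ℂ] K} {Λ : E →L[ℂ] K}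
    {Z : E} (hA : DifferentiableAt ℂ A Z) (hh : DifferentiableAt ℂ h Z)
    (hright : ∀ᶠ W in 𝓝 Z, Λ.comp ((A W).comp (h W)) = .id ℂ K)
    (hleft : ∀ ξ, h Z (Λ (A Z ξ)) = ξ) (ξ η : K) :
    skewPart ((fderiv ℂ (fun W => (A W).comp (h W)) Z).comp ((A Z).comp (h Z))) ξ η =
      skewPart ((fderiv ℂ A Z).comp (A Z)) (h Z ξ) (h Z η) -
        A Z (h Z (Λ (skewPart ((fderiv ℂ A Z).comp (A Z)) (h Z ξ) (h Z η)))) := by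
  have hd := hA.hasFDerivAt.clm_comp hh.hasFDerivAt
  have hzero : ∀ u ζ, Λ (fderiv ℂ (fun W => (A W).comp (h W)) Z u ζ) = 0 := by
    intro u ζ
    have h1 := (hasFDerivAt_const Λ Z).clm_comp (hd.differentiableAt.hasFDerivAt)
    have h2 := h1.unique ((hasFDerivAt_const (ContinuousLinearMap.id ℂ K) Z).congr_of_eventuallyEq
      hright)
    simpa using congrArg (fun D => D u ζ) h2
  have h3 := hzero (A Z (h Z ξ)) η
  have h4 := hzero (A Z (h Z η)) ξ
  rw [hd.fderiv] at h3 h4 ⊢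
  simp only [skewPart_apply, ContinuousLinearMap.comp_apply, add_apply, map_add, map_sub,
    ContinuousLinearMap.compL_apply, ContinuousLinearMap.flip_apply] at h3 h4 ⊢
  have h5 := eq_neg_of_add_eq_zero_right h3
  have h6 := eq_neg_of_add_eq_zero_right h4
  rw [h5, h6]
  simp only [map_neg, hleft]
  abel

theorem norm_le_sum_norm_apply_single {n : ℕ} (T : (Fin n → ℂ) →L[ℂ] G) :
    ‖T‖ ≤ ∑ i, ‖T (Pi.single i 1)‖ := by
  refine T.opNorm_le_bound (by positivity) fun ξ => ?_
  have h1 : T ξ = ∑ i, ξ i • T (Pi.single i 1) := by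
    conv_lhs => rw [pi_eq_sum_univ' ξ]
    simp [Pi.single]
  rw [h1, Finset.sum_mul]
  refine norm_sum_le_of_le _ fun i _ => ?_
  rw [norm_smul, mul_comm]
  gcongr
  exact norm_le_pi_norm ξ i

theorem skewPart_fderiv_reframe_isLittleO {E : Type} [NormedAddCommGroup E] [NormedSpace ℂ E]
    {n k : ℕ} {A : E → (Fin n → ℂ) →L[ℂ] E}
    {h : E → (Fin n → ℂ) →L[ℂ] (Fin n → ℂ)} {Λ : E →L[ℂ] (Fin n → ℂ)}
    (hA : ContDiffAt ℂ 1 A 0) (hh : ContDiffAt ℂ 1 h 0)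
    (hright : ∀ᶠ Z in 𝓝 0, Λ.comp ((A Z).comp (h Z)) = .id ℂ _)
    (hleft : ∀ᶠ Z in 𝓝 0, ∀ ξ, h Z (Λ (A Z ξ)) = ξ) (d : Fin n → Fin n → E → Fin n → ℂ)
    (hbr : ∀ i j, (fun Z => skewPart ((fderiv ℂ A Z).comp (A Z)) (Pi.single i 1) (Pi.single j 1) -
      A Z (d i j Z)) =o[𝓝 0] fun Z => ‖Z‖ ^ k) :
    (fun Z => skewPart ((fderiv ℂ (fun W => (A W).comp (h W)) Z).comp ((A Z).comp (h Z))))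
      =o[𝓝 0] fun Z => ‖Z‖ ^ k := by
  let q : E → E →L[ℂ] E := fun Z => .id ℂ E - ((A Z).comp (h Z)).comp Λ
  let e : Fin n → Fin n → E → E := fun i j Z =>
    skewPart ((fderiv ℂ A Z).comp (A Z)) (Pi.single i 1) (Pi.single j 1) - A Z (d i j Z)
  have hM : (fun Z => ‖q Z‖ * ‖h Z‖ ^ 2) =O[𝓝 0] fun _ : E => (1 : ℝ) := by
    have hq : ContinuousAt q 0 := continuousAt_const.sub
      ((hA.continuousAt.clm_comp hh.continuousAt).clm_comp continuousAt_const)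
    exact (hq.norm.mul (hh.continuousAt.norm.pow 2)).isBigO_one ℝ
  have hsum : (fun Z => ∑ i, ∑ j, ‖e i j Z‖) =o[𝓝 0] fun Z => ‖Z‖ ^ k :=
    .fun_sum fun i _ => .fun_sum fun j _ => (hbr i j).norm_left
  have hmain := hM.mul_isLittleO hsum
  simp only [one_mul] at hmain
  refine IsBigO.trans_isLittleO (IsBigO.of_norm_eventuallyLE ?_) hmain
  filter_upwards [hA.eventually (by simp), hh.eventually (by simp), hright.eventually_nhds, hleft]
    with Z hAZ hhZ hr hl
  have hq0 : ∀ ξ, q Z (A Z ξ) = 0 := fun ξ => by simp [q, hl]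
  let R : (Fin n → ℂ) →L[ℂ] (Fin n → ℂ) →L[ℂ] E :=
    (ContinuousLinearMap.compL ℂ _ E E (q Z)).comp (skewPart ((fderiv ℂ A Z).comp (A Z)))
  have hRapply : ∀ ξ η, R ξ η = q Z (skewPart ((fderiv ℂ A Z).comp (A Z)) ξ η) := fun _ _ => rfl
  have hR : ‖R‖ ≤ ‖q Z‖ * ∑ i, ∑ j, ‖e i j Z‖ := by
    refine (norm_le_sum_norm_apply_single R).trans ?_
    rw [Finset.mul_sum]
    refine Finset.sum_le_sum fun i _ => (norm_le_sum_norm_apply_single _).trans ?_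
    rw [Finset.mul_sum]
    refine Finset.sum_le_sum fun j _ => ?_
    have h1 : R (Pi.single i 1) (Pi.single j 1) = q Z (e i j Z) := by
      simp only [e, map_sub, hq0, sub_zero, hRapply]
    rw [h1]
    exact (q Z).le_opNorm _
  refine ContinuousLinearMap.opNorm_le_bound₂ _ (by positivity) fun ξ η => ?_
  have h2 : skewPart ((fderiv ℂ (fun W => (A W).comp (h W)) Z).comp ((A Z).comp (h Z))) ξ η =
      R (h Z ξ) (h Z η) :=
    skewPart_fderiv_reframe_apply (hAZ.differentiableAt one_ne_zero)
      (hhZ.differentiableAt one_ne_zero) hr hl ξ η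
  rw [h2]
  calc ‖R (h Z ξ) (h Z η)‖ ≤ ‖R‖ * ‖h Z ξ‖ * ‖h Z η‖ := R.le_opNorm₂ _ _
    _ ≤ (‖q Z‖ * ∑ i, ∑ j, ‖e i j Z‖) * (‖h Z‖ * ‖ξ‖) * (‖h Z‖ * ‖η‖) := by
      gcongr
      · exact (h Z).le_opNorm _
      · exact (h Z).le_opNorm _
    _ = _ := by ring

end Frames

section Normalization

theorem LinearIndependent.exists_linearEquiv_apply_eq {𝕜 V ι : Type*} [Field 𝕜] [AddCommGroup V]
    [Module 𝕜 V] [Finite ι] {v w : ι → V} (hv : LinearIndependent 𝕜 v)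
    (hw : LinearIndependent 𝕜 w) : ∃ T : V ≃ₗ[𝕜] V, ∀ i, T (v i) = w i := by
  have : FiniteDimensional 𝕜 (Submodule.span 𝕜 (range v)) :=
    FiniteDimensional.span_of_finite 𝕜 (finite_range v)
  obtain ⟨T, hT⟩ := Submodule.exists_linearEquiv_restrict_eq
    (hv.linearCombinationEquiv.symm ≪≫ₗ hw.linearCombinationEquiv)
  refine ⟨T, fun i => ?_⟩
  have h1 : (hv.linearCombinationEquiv (Finsupp.single i 1) : V) = v i := by simp
  rw [← h1, ← hT]
  simp

theorem norm_sub_le_mul_norm_image_sub {E G : Type*} [NormedAddCommGroup E] [NormedSpace ℂ E]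
    [NormedAddCommGroup G] [NormedSpace ℂ G] (T : E ≃L[ℂ] G) {f : E → G} {s : Set E}
    (hs : Convex ℝ s) (hf : ∀ Z ∈ s, DifferentiableAt ℂ f Z)
    (hb : ∀ Z ∈ s, ‖fderiv ℂ f Z - T‖ ≤ (2 * (‖(T.symm : G →L[ℂ] E)‖ + 1))⁻¹) {Z W : E}
    (hZ : Z ∈ s) (hW : W ∈ s) :
    ‖Z - W‖ ≤ 2 * (‖(T.symm : G →L[ℂ] E)‖ + 1) * ‖f Z - f W‖ := by
  set M := ‖(T.symm : G →L[ℂ] E)‖ + 1 with hM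
  have hM0 : 0 < M := by positivity
  have h1 := hs.norm_image_sub_le_of_norm_hasFDerivWithin_le'
    (fun Z hZ => (hf Z hZ).hasFDerivAt.hasFDerivWithinAt) hb hW hZ
  have h2 : ‖T (Z - W)‖ ≤ ‖f Z - f W‖ + (2 * M)⁻¹ * ‖Z - W‖ := by
    refine le_trans ?_ (add_le_add_right h1 _)
    have := norm_sub_le (f Z - f W) (f Z - f W - T (Z - W))
    rwa [sub_sub_cancel] at this
  have h3 : ‖Z - W‖ ≤ M * ‖T (Z - W)‖ := by
    have h4 := (T.symm : G →L[ℂ] E).le_opNorm (T (Z - W))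
    simp only [ContinuousLinearEquiv.coe_coe, ContinuousLinearEquiv.symm_apply_apply] at h4
    refine h4.trans ?_
    gcongr
    linarith
  have h5 : M * ‖T (Z - W)‖ ≤ M * ‖f Z - f W‖ + ‖Z - W‖ / 2 := by
    calc M * ‖T (Z - W)‖ ≤ M * (‖f Z - f W‖ + (2 * M)⁻¹ * ‖Z - W‖) := by gcongr
      _ = M * ‖f Z - f W‖ + ‖Z - W‖ / 2 := by field_simp
  linarith

theorem span_range_apply_single {E : Type*} [AddCommGroup E] [Module ℂ E] {n : ℕ}
    (B : (Fin n → ℂ) →ₗ[ℂ] E) :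
    Submodule.span ℂ (range fun i => B (Pi.single i 1)) = LinearMap.range B := by
  rw [LinearMap.range_eq_map, ← (Pi.basisFun ℂ (Fin n)).span_eq, Submodule.map_span, ← range_comp]
  congr 2
  ext i
  simp

theorem Filter.Eventually.slice {E Y : Type*} [TopologicalSpace E] [TopologicalSpace Y] {Z₀ : E}
    {x₀ : Y} {p : E × Y → Prop} (h : ∀ᶠ y in 𝓝 (Z₀, x₀), p y) :
    ∀ᶠ x in 𝓝 x₀, ∀ᶠ Z in 𝓝 Z₀, p (Z, x) := by
  rw [nhds_prod_eq, eventually_swap_iff] at h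
  exact h.curry

/-- The frame `(v i)` as the linear map `ξ ↦ ∑ i, ξ i • v i`. -/
noncomputable def frameMap {E : Type*} [NormedAddCommGroup E] [NormedSpace ℂ E] {n : ℕ}
    (v : Fin n → E) : (Fin n → ℂ) →L[ℂ] E :=
  ∑ i, ContinuousLinearMap.smulRightL ℂ (Fin n → ℂ) E (.proj i) (v i)

theorem frameMap_apply {E : Type*} [NormedAddCommGroup E] [NormedSpace ℂ E] {n : ℕ}
    (v : Fin n → E) (ξ : Fin n → ℂ) : frameMap v ξ = ∑ i, ξ i • v i := by
  simp [frameMap]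

theorem frameMap_single {E : Type*} [NormedAddCommGroup E] [NormedSpace ℂ E] {n : ℕ}
    (v : Fin n → E) (i : Fin n) : frameMap v (Pi.single i 1) = v i := by
  rw [frameMap_apply, Finset.sum_eq_single i] <;> simp +contextual

theorem skewPart_fderiv_frameMap {E : Type} [NormedAddCommGroup E] [NormedSpace ℂ E] {n : ℕ}
    {L : Fin n → E → E} {Z : E} (hL : DifferentiableAt ℂ (fun W => frameMap fun i => L i W) Z)
    (i j : Fin n) :
    skewPart ((fderiv ℂ (fun W => frameMap fun i => L i W) Z).comp (frameMap fun i => L i Z))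
      (Pi.single i 1) (Pi.single j 1) = lieBracketVF (L i) (L j) Z := by
  have h1 : ∀ i u, fderiv ℂ (fun W => frameMap fun i => L i W) Z u (Pi.single i 1) =
      fderiv ℂ (L i) Z u := by
    intro i u
    have h2 := hL.hasFDerivAt.clm_apply (hasFDerivAt_const (Pi.single i (1 : ℂ)) Z)
    simp only [frameMap_single] at h2
    rw [h2.fderiv]
    simp
  simp only [skewPart_apply, ContinuousLinearMap.comp_apply, h1, frameMap_single, lieBracketVF]

end Normalization

section AdaptedCoordinates

theorem Asymptotics.IsLittleO.clm_apply_const {α E G : Type*} [NormedAddCommGroup E]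
    [NormedSpace ℂ E] [NormedAddCommGroup G] [NormedSpace ℂ G] {B : α → E →L[ℂ] G} {g : α → ℝ}
    {l : Filter α} (hB : B =o[l] g) (v : E) : (fun a => B a v) =o[l] g :=
  IsBigO.trans_isLittleO (.of_bound ‖v‖ (.of_forall fun a => by
    rw [mul_comm]
    exact (B a).le_opNorm v)) hB

/-- A frame that is involutive to order `k` has an adapted frame `A (·) (Pi.single i 1)` and
coordinates `F` straightening it to order `k + 1`. -/
theorem exists_adapted_frame_coordinates {m n k : ℕ} (hnm : n ≤ m) {Y : Type}
    [NormedAddCommGroup Y] [NormedSpace ℝ Y] {x₀ : Y} {μ : ℕ∞} (hμ : 1 ≤ μ)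
    {L : Fin n → (Fin m → ℂ) × Y → (Fin m → ℂ)} (hL : ∀ i, SmoothHolAt μ (L i) x₀)
    (hLind : LinearIndependent ℂ fun i => L i (0, x₀))
    {c : Fin n → Fin n → Fin n → (Fin m → ℂ) × Y → ℂ}
    (hbracket : ∀ᶠ x in 𝓝 x₀, ∀ i j,
      (fun Z => lieBracketVF (fun Z' => L i (Z', x)) (fun Z' => L j (Z', x)) Z
          - ∑ s, c i j s (Z, x) • L s (Z, x))
        =o[𝓝 0] fun Z : Fin m → ℂ => ‖Z‖ ^ k) :
    ∃ (A : (Fin m → ℂ) × Y → (Fin n → ℂ) →L[ℂ] (Fin m → ℂ))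
      (F : (Fin m → ℂ) × Y → (Fin m → ℂ)) (T : (Fin m → ℂ) ≃L[ℂ] (Fin m → ℂ)),
      SmoothHolAt μ A x₀ ∧ SmoothHolAt μ F x₀ ∧ (∀ x, F (0, x) = 0) ∧
      fderiv ℂ (fun Z => F (Z, x₀)) 0 = T ∧
      (∀ᶠ p in 𝓝 (0, x₀), Submodule.span ℂ (range fun i => A p (Pi.single i 1)) =
        Submodule.span ℂ (range fun i => L i p)) ∧
      ∀ᶠ x in 𝓝 x₀, ∀ i, (fun Z => fderiv ℂ (fun W => F (W, x)) Z (A (Z, x) (Pi.single i 1)) -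
        Pi.single (Fin.castLE hnm i) 1) =o[𝓝 0] fun Z : Fin m → ℂ => ‖Z‖ ^ (k + 1) := by
  let A : (Fin m → ℂ) × Y → (Fin n → ℂ) →L[ℂ] (Fin m → ℂ) := fun p =>
    frameMap fun i => L i p
  have hA : SmoothHolAt μ A x₀ := SmoothHolAt.sum _ fun i _ => (hL i).clm_const _
  have hw : LinearIndependent ℂ fun i : Fin n =>
      (Pi.single (Fin.castLE hnm i) 1 : Fin m → ℂ) := by
    simpa [Function.comp_def] using (Pi.basisFun ℂ (Fin m)).linearIndependent.comp _
      (Fin.castLE_injective hnm)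
  obtain ⟨T₀, hT₀⟩ := hLind.exists_linearEquiv_apply_eq hw
  let T : (Fin m → ℂ) ≃L[ℂ] (Fin m → ℂ) := T₀.toContinuousLinearEquiv
  have hT : ∀ i, T (L i (0, x₀)) = Pi.single (Fin.castLE hnm i) 1 := hT₀
  let Λ : (Fin m → ℂ) →L[ℂ] (Fin n → ℂ) :=
    ContinuousLinearMap.pi fun i =>
      (ContinuousLinearMap.proj (R := ℂ) (φ := fun _ : Fin m => ℂ) (Fin.castLE hnm i)).comp
        (T : (Fin m → ℂ) →L[ℂ] _)
  have hΛ0 : Λ.comp (A (0, x₀)) = 1 := by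
    ext ξ i
    simp [Λ, A, frameMap_apply, hT, Pi.single_apply, Fin.castLE_inj]
  let h : (Fin m → ℂ) × Y → (Fin n → ℂ) →L[ℂ] (Fin n → ℂ) := fun p =>
    Ring.inverse (Λ.comp (A p))
  have hΛA : SmoothHolAt μ (fun p => Λ.comp (A p)) x₀ := (SmoothHolAt.const Λ).clm_comp hA
  have hh : SmoothHolAt μ h x₀ := by
    refine SmoothHolAt.comp (h := Ring.inverse) ?_ hΛA
    rw [hΛ0]
    exact contDiffAt_ringInverse ℂ 1
  have hunit : ∀ᶠ p in 𝓝 (0, x₀), IsUnit (Λ.comp (A p)) :=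
    hΛA.contDiffAt.continuousAt.eventually
      (Units.isOpen.mem_nhds (show IsUnit (Λ.comp (A (0, x₀))) by rw [hΛ0]; exact isUnit_one))
  have hright : ∀ p, IsUnit (Λ.comp (A p)) → Λ.comp ((A p).comp (h p)) = .id ℂ _ := fun p hp =>
    Ring.mul_inverse_cancel _ hp
  have hleft : ∀ p, IsUnit (Λ.comp (A p)) → ∀ ξ, h p (Λ (A p ξ)) = ξ := fun p hp ξ =>
    DFunLike.congr_fun (Ring.inverse_mul_cancel _ hp) ξ
  let A' : (Fin m → ℂ) × Y → (Fin n → ℂ) →L[ℂ] (Fin m → ℂ) := fun p =>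
    (A p).comp (h p)
  have hA' : SmoothHolAt μ A' x₀ := hA.clm_comp hh
  have hA'0 : A' (0, x₀) = A (0, x₀) := by
    simp only [A', h, hΛ0, Ring.inverse_one]
    rfl
  have hB : ∀ᶠ x in 𝓝 x₀,
      (fun Z => skewPart ((fderiv ℂ (fun W => A' (W, x)) Z).comp (A' (Z, x))))
        =o[𝓝 0] fun Z => ‖Z‖ ^ k := by
    filter_upwards [hA.eventually, hh.eventually, hunit.slice, hbracket]
      with x hAx hhx hux hbx
    have hA1 : ContDiffAt ℂ 1 (fun Z => A (Z, x)) 0 := mod_cast hAx.contDiffAt_slice hμ 1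
    have hh1 : ContDiffAt ℂ 1 (fun Z => h (Z, x)) 0 := mod_cast hhx.contDiffAt_slice hμ 1
    refine skewPart_fderiv_reframe_isLittleO hA1 hh1 (hux.mono fun Z => hright (Z, x))
      (hux.mono fun Z => hleft (Z, x)) (fun i j Z s => c i j s (Z, x)) fun i j => ?_
    refine (hbx i j).congr' ?_ .rfl
    filter_upwards [hA1.eventually (by simp)] with Z hZ
    rw [← skewPart_fderiv_frameMap (L := fun i Z => L i (Z, x)) (hZ.differentiableAt one_ne_zero)]
    simp only [A, frameMap_apply]
  have hΛA' : ∀ᶠ x in 𝓝 x₀, ∀ ξ, Λ (A' (0, x) ξ) = ξ := by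
    filter_upwards [hunit.slice] with x hx ξ
    exact DFunLike.congr_fun (hright (0, x) hx.self_of_nhds) ξ
  obtain ⟨F, hF, hF0, hFT, hFo⟩ := exists_fderiv_comp_sub_isLittleO hμ hA' hΛA'
    (T := (T : (Fin m → ℂ) →L[ℂ] (Fin m → ℂ))) rfl hB (k + 1) le_rfl
  refine ⟨A', F, T, hA', hF, hF0, hFT, ?_, ?_⟩
  · filter_upwards [hunit] with p hp
    have h1 : (fun i => L i p) = fun i => A p (Pi.single i 1) := by
      simp only [A, frameMap_single]
    rw [h1]
    refine (span_range_apply_single (A' p).toLinearMap).trans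
      (Eq.trans ?_ (span_range_apply_single (A p).toLinearMap).symm)
    refine LinearMap.range_comp_of_range_eq_top _ (LinearMap.range_eq_top.2 fun ξ => ?_)
    exact ⟨_, hleft p hp ξ⟩
  · filter_upwards [hFo] with x hx i
    have hJ : (T : (Fin m → ℂ) →L[ℂ] (Fin m → ℂ)).comp (A' (0, x₀)) (Pi.single i 1) =
        Pi.single (Fin.castLE hnm i) 1 := by
      rw [hA'0]
      simp [A, frameMap_single, hT]
    rw [← hJ]
    exact hx.clm_apply_const (Pi.single i 1)

theorem eventually_fderiv_near_equiv {E G Y : Type u} [NormedAddCommGroup E]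
    [NormedSpace ℂ E] [FiniteDimensional ℂ E] [CompleteSpace E] [NormedAddCommGroup G]
    [NormedSpace ℂ G] [CompleteSpace G]
    [NormedAddCommGroup Y] [NormedSpace ℝ Y] {μ : ℕ∞} (hμ : 1 ≤ μ) {x₀ : Y} {F : E × Y → G}
    (hF : SmoothHolAt μ F x₀) {T : E ≃L[ℂ] G} (hT : fderiv ℂ (fun Z => F (Z, x₀)) 0 = T) {ε : ℝ}
    (hε : 0 < ε) : ∀ᶠ p in 𝓝 (0, x₀), ‖fderiv ℂ (fun Z => F (Z, p.2)) p.1 - T‖ ≤ ε ∧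
      Function.Bijective (fderiv ℂ (fun Z => F (Z, p.2)) p.1) := by
  have hDF : Tendsto (fun p : E × Y => fderiv ℂ (fun Z => F (Z, p.2)) p.1) (𝓝 (0, x₀)) (𝓝 T) := by
    rw [← hT]
    exact (hF.fderiv hμ).contDiffAt.continuousAt.tendsto
  filter_upwards [hDF.eventually (closedBall_mem_nhds _ hε), hDF.eventually T.nhds] with p hp hpe
  refine ⟨mem_closedBall_iff_norm.1 hp, ?_⟩
  obtain ⟨e, he⟩ := hpe
  rw [← he]
  exact e.bijective

end AdaptedCoordinates

end ApproximateFrobenius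

/-- Approximate holomorphic Frobenius theorem with smooth dependence on real parameters:
given vector fields `L₁(·;x), …, Lₙ(·;x)` on a neighborhood of `0` in `ℂ^m`, jointly `C^μ`
in `(Z, x)` and holomorphic in `Z` for each fixed parameter `x`, pointwise linearly
independent, and satisfying the approximate involutivity condition
`[Lᵢ(·;x), Lⱼ(·;x)](Z) = Σₛ cˢᵢⱼ(Z;x) Lₛ(Z;x) + o(|Z|^k)` for each fixed `x`, there exist
vector fields `L̃ᵢ(·;x)` and local biholomorphic coordinate changes `Z̃(·;x)` fixing `0`,
all jointly `C^μ` and holomorphic in `Z` for fixed `x`, spanning the same subspaces and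
satisfying `L̃ᵢ = ∂/∂Z̃ᵢ + o(|Z̃|^{k+1})` in the new coordinates, for each fixed `x`. -/
theorem approx_holomorphic_frobenius_with_parameters {m n k q : ℕ} (hnm : n ≤ m)
    (μ : ℕ∞) (hμ : 1 ≤ μ)
    (U : Set (Fin m → ℂ)) (hU : IsOpen U) (hU0 : (0 : Fin m → ℂ) ∈ U)
    (X : Set (Fin q → ℝ)) (hX : IsOpen X)
    (L : Fin n → (Fin m → ℂ) × (Fin q → ℝ) → (Fin m → ℂ))
    (hLsmooth : ∀ i, ContDiffOn ℝ μ (L i) (U ×ˢ X))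
    (hLhol : ∀ i, ∀ x ∈ X, DifferentiableOn ℂ (fun Z => L i (Z, x)) U)
    (hLind : ∀ Z ∈ U, ∀ x ∈ X, LinearIndependent ℂ (fun i => L i (Z, x)))
    (c : Fin n → Fin n → Fin n → (Fin m → ℂ) × (Fin q → ℝ) → ℂ)
    (hcsmooth : ∀ i j s, ContDiffOn ℝ μ (c i j s) (U ×ˢ X))
    (hchol : ∀ i j s, ∀ x ∈ X, DifferentiableOn ℂ (fun Z => c i j s (Z, x)) U)
    (hbracket : ∀ i j, ∀ x ∈ X,
      (fun Z => lieBracketVF (fun Z' => L i (Z', x)) (fun Z' => L j (Z', x)) Z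
          - ∑ s, c i j s (Z, x) • L s (Z, x))
        =o[𝓝 0] fun Z : Fin m → ℂ => ‖Z‖ ^ k) :
    ∀ x₀ ∈ X,
    ∃ V : Set (Fin m → ℂ), IsOpen V ∧ (0 : Fin m → ℂ) ∈ V ∧ V ⊆ U ∧
    ∃ P : Set (Fin q → ℝ), IsOpen P ∧ x₀ ∈ P ∧ P ⊆ X ∧
    ∃ (Lt : Fin n → (Fin m → ℂ) × (Fin q → ℝ) → (Fin m → ℂ))
      (Zt : (Fin m → ℂ) × (Fin q → ℝ) → (Fin m → ℂ)),
      -- joint smoothness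
      (∀ i, ContDiffOn ℝ μ (Lt i) (V ×ˢ P)) ∧ ContDiffOn ℝ μ Zt (V ×ˢ P) ∧
      -- holomorphy in `Z` for each fixed `x`
      (∀ i, ∀ x ∈ P, DifferentiableOn ℂ (fun Z => Lt i (Z, x)) V) ∧
      (∀ x ∈ P, DifferentiableOn ℂ (fun Z => Zt (Z, x)) V) ∧
      -- `Z̃(·;x)` is a local biholomorphic change of coordinates fixing `0`
      (∀ x ∈ P, Zt (0, x) = 0) ∧
      (∀ x ∈ P, Set.InjOn (fun Z => Zt (Z, x)) V) ∧
      (∀ x ∈ P, ∀ Z ∈ V, Function.Bijective (fderiv ℂ (fun Z' => Zt (Z', x)) Z)) ∧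
      -- `L̃ᵢ(·;x)` spans the same subspace as `L₁(·;x), …, Lₙ(·;x)` at every point
      (∀ x ∈ P, ∀ Z ∈ V, Submodule.span ℂ (Set.range fun i => Lt i (Z, x))
          = Submodule.span ℂ (Set.range fun i => L i (Z, x))) ∧
      -- in the coordinates `Z̃(·;x)` one has `L̃ᵢ = ∂/∂Z̃ᵢ + o(|Z̃|^{k+1})`
      (∀ x ∈ P, ∀ i,
        (fun Z => fderiv ℂ (fun Z' => Zt (Z', x)) Z (Lt i (Z, x))
            - Pi.single (Fin.castLE hnm i) 1)
          =o[𝓝[V] 0] fun Z => ‖Zt (Z, x)‖ ^ (k + 1)) := by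
  intro x₀ hx₀
  have hUX : ∀ᶠ p : (Fin m → ℂ) × (Fin q → ℝ) in 𝓝 (0, x₀), p ∈ U ×ˢ X :=
    (hU.prod hX).mem_nhds ⟨hU0, hx₀⟩
  have hL : ∀ i, SmoothHolAt μ (L i) x₀ := fun i => by
    filter_upwards [hUX] with p hp
    exact ⟨(hLsmooth i).contDiffAt ((hU.prod hX).mem_nhds hp),
      (hLhol i p.2 hp.2).differentiableAt (hU.mem_nhds hp.1)⟩
  have hX' : ∀ᶠ x in 𝓝 x₀, x ∈ X := hX.mem_nhds hx₀
  obtain ⟨A, F, T, hA, hF, hF0, hFT, hspan, hFo⟩ :=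
    exists_adapted_frame_coordinates hnm hμ hL (hLind 0 hU0 x₀ hx₀)
      (hX'.mono fun x hx i j => hbracket i j x hx)
  set M : ℝ := 2 * (‖(T.symm : (Fin m → ℂ) →L[ℂ] (Fin m → ℂ))‖ + 1)
  have hM0 : 0 < M⁻¹ := by positivity
  have hnear := eventually_fderiv_near_equiv hμ hF hFT hM0
  have hsnd : Filter.Tendsto (fun p : (Fin m → ℂ) × (Fin q → ℝ) => p.2) (𝓝 (0, x₀)) (𝓝 x₀) :=
    continuous_snd.tendsto _
  obtain ⟨δ, hδ, hgood⟩ := Metric.eventually_nhds_iff_ball.1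
    (hUX.and (hA.and (hF.and (hnear.and (hspan.and (hsnd.eventually hFo))))))
  rw [← ball_prod_same] at hgood
  have h0 : (0 : Fin m → ℂ) ∈ Metric.ball (0 : Fin m → ℂ) δ := Metric.mem_ball_self hδ
  have hx0 : x₀ ∈ Metric.ball x₀ δ := Metric.mem_ball_self hδ
  have hanti : ∀ x ∈ Metric.ball x₀ δ, ∀ Z ∈ Metric.ball (0 : Fin m → ℂ) δ,
      ∀ W ∈ Metric.ball (0 : Fin m → ℂ) δ, ‖Z - W‖ ≤ M * ‖F (Z, x) - F (W, x)‖ :=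
    fun x hx Z hZ W hW => by
      refine norm_sub_le_mul_norm_image_sub T (f := fun Z => F (Z, x)) (convex_ball _ _)
        (fun Z hZ => ?_) (fun Z hZ => ?_) hZ hW
      · exact (hgood (Z, x) ⟨hZ, hx⟩).2.2.1.2
      · exact (hgood (Z, x) ⟨hZ, hx⟩).2.2.2.1.1
  refine ⟨Metric.ball 0 δ, Metric.isOpen_ball, h0, fun Z hZ => (hgood (Z, x₀) ⟨hZ, hx0⟩).1.1,
    Metric.ball x₀ δ, Metric.isOpen_ball, hx0, fun x hx => (hgood (0, x) ⟨h0, hx⟩).1.2,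
    fun i p => A p (Pi.single i 1), F, fun i p hp => ?_, fun p hp => ?_, fun i x hx Z hZ => ?_,
    fun x hx Z hZ => ?_, fun x _ => hF0 x, fun x hx Z hZ W hW hZW => ?_,
    fun x hx Z hZ => (hgood (Z, x) ⟨hZ, hx⟩).2.2.2.1.2,
    fun x hx Z hZ => (hgood (Z, x) ⟨hZ, hx⟩).2.2.2.2.1, fun x hx i => ?_⟩
  · exact (ContDiffAt.clm_apply_restrictScalars (hgood p hp).2.1.1
      contDiffAt_const).contDiffWithinAt
  · exact (hgood p hp).2.2.1.1.contDiffWithinAt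
  · exact ((hgood (Z, x) ⟨hZ, hx⟩).2.1.2.clm_apply
      (differentiableAt_const _)).differentiableWithinAt
  · exact (hgood (Z, x) ⟨hZ, hx⟩).2.2.1.2.differentiableWithinAt
  · have h1 := hanti x hx Z hZ W hW
    rw [show F (Z, x) = F (W, x) from hZW, sub_self, norm_zero, mul_zero] at h1
    exact sub_eq_zero.1 (norm_le_zero_iff.1 h1)
  · refine (((hgood (0, x) ⟨h0, hx⟩).2.2.2.2.2 i).mono nhdsWithin_le_nhds).trans_isBigO
      (IsBigO.pow (IsBigO.of_bound M ?_) _)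
    filter_upwards [self_mem_nhdsWithin] with Z hZ
    simpa [hF0] using hanti x hx Z hZ 0 h0
end

section
/- Let k ≥ 0 be an integer and write ℂ^m = ℂ^n_z × ℂ^{m−n}_w. Let L₁, …, Lₙ be holomorphic vector fields on a neighborhood of 0 in ℂ^m of the form L_i = ∂/∂z_i + Σ_{j=1}^{m−n} a_i^j(z, w) ∂/∂w_j with a_i^j holomorphic, satisfying [L_i, L_j](Z) = o(|Z|^k) as Z → 0 for all 1 ≤ i, j ≤ n. Then for every holomorphic function g defined near 0 in ℂ^m, every integer 1 ≤ s ≤ k + 2, all indices i₁, …, i_s ∈ {1, …, n}, and every permutation σ of {1, …, s}, one has (L_{i_1} ⋯ L_{i_s} g)(0, w) = (L_{i_{σ(1)}} ⋯ L_{i_{σ(s)}} g)(0, w) + o(|w|^{k+2−s}) as w → 0. -/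
open Asymptotics Topology

/-- The action of a vector field `L` on a function `f` as a first-order differential
operator: `(Lf)(Z) = Df(Z)·L(Z)`. -/
noncomputable def applyVF {E : Type*} [NormedAddCommGroup E] [NormedSpace ℂ E]
    (L : E → E) (f : E → ℂ) : E → ℂ :=
  fun Z => fderiv ℂ f Z (L Z)

/-- Successive application `L_{i₁} ⋯ L_{i_s} f` of a list of vector fields (the head of
the list being the outermost operator). -/
noncomputable def iterApplyVF {E : Type*} [NormedAddCommGroup E] [NormedSpace ℂ E]
    (Ls : List (E → E)) (f : E → ℂ) : E → ℂ :=
  Ls.foldr applyVF f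

/-- The derivative of a holomorphic map is locally bounded. -/
theorem exists_eventually_norm_fderiv_le {E F : Type*}
    [NormedAddCommGroup E] [NormedSpace ℂ E] [NormedAddCommGroup F] [NormedSpace ℂ F]
    {f : E → F} {U : Set E} (hf : DifferentiableOn ℂ f U) (hU : IsOpen U) {x : E} (hx : x ∈ U) :
    ∃ C : ℝ, ∀ᶠ y in 𝓝 x, ‖fderiv ℂ f y‖ ≤ C := by
  have hc : ContinuousAt f x := (hf.differentiableAt (hU.mem_nhds hx)).continuousAt
  obtain ⟨ε, hε, hball⟩ := Metric.mem_nhds_iff.1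
    (Filter.inter_mem (hU.mem_nhds hx) (hc.preimage_mem_nhds (Metric.ball_mem_nhds _ one_pos)))
  refine ⟨2 / (ε / 2), ?_⟩
  filter_upwards [Metric.ball_mem_nhds x (half_pos hε)] with y hy
  have hsub : Metric.ball y (ε / 2) ⊆ Metric.ball x ε := by
    refine Metric.ball_subset_ball' ?_
    linarith [Metric.mem_ball.1 hy]
  refine Complex.norm_fderiv_le_div_of_mapsTo_ball
    (hf.mono fun z hz => (hball (hsub hz)).1) (fun z hz => ?_) (half_pos hε)
  have h1 : dist (f z) (f x) < 1 := (hball (hsub hz)).2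
  have h2 : dist (f y) (f x) < 1 := (hball (hsub (Metric.mem_ball_self (half_pos hε)))).2
  rw [Metric.mem_closedBall]
  linarith [dist_triangle_right (f z) (f y) (f x)]

/-- Directional derivatives of a holomorphic map are holomorphic: differentiate the Cauchy
integral formula on a disc in the direction `v` under the integral sign. -/
theorem differentiableOn_fderiv_apply {E F : Type*}
    [NormedAddCommGroup E] [NormedSpace ℂ E] [FiniteDimensional ℂ E]
    [NormedAddCommGroup F] [NormedSpace ℂ F] [FiniteDimensional ℂ F]
    {f : E → F} {U : Set E} (hf : DifferentiableOn ℂ f U) (hU : IsOpen U) (v : E) :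
    DifferentiableOn ℂ (fun x => fderiv ℂ f x v) U := by
  intro x hx
  refine DifferentiableAt.differentiableWithinAt ?_
  have : CompleteSpace F := FiniteDimensional.complete ℂ F
  have : ProperSpace (E →L[ℂ] F) := FiniteDimensional.proper ℂ _
  let : MeasurableSpace E := borel E
  have : BorelSpace E := ⟨rfl⟩
  obtain ⟨C, hC⟩ := exists_eventually_norm_fderiv_le hf hU hx
  obtain ⟨ε, hε, hball⟩ := Metric.mem_nhds_iff.1 (Filter.inter_mem (hU.mem_nhds hx) hC)
  set r : ℝ := ε / 2 / (‖v‖ + 1) with hr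
  have hr0 : 0 < r := by positivity
  have hrv : r * ‖v‖ ≤ ε / 2 := by
    rw [hr, div_mul_eq_mul_div, div_le_iff₀ (by positivity)]
    nlinarith [norm_nonneg v]
  have hmem : ∀ y ∈ Metric.ball x (ε / 2), ∀ ζ : ℂ, ‖ζ‖ ≤ r →
      y + ζ • v ∈ Metric.ball x ε := by
    intro y hy ζ hζ
    rw [Metric.mem_ball, dist_eq_norm_sub] at hy ⊢
    calc ‖y + ζ • v - x‖ = ‖(y - x) + ζ • v‖ := by congr 1; abel
      _ ≤ ‖y - x‖ + ‖ζ‖ * ‖v‖ := (norm_add_le _ _).trans_eq (by rw [norm_smul])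
      _ ≤ ‖y - x‖ + r * ‖v‖ := by gcongr
      _ < ε := by linarith
  have hdiff : ∀ y ∈ Metric.ball x ε, DifferentiableAt ℂ f y := fun y hy =>
    hf.differentiableAt (hU.mem_nhds (hball hy).1)
  have hcircle : ∀ θ : ℝ, ‖circleMap 0 r θ‖ ≤ r := fun θ => by
    simp [abs_of_pos hr0]
  set c : ℝ → ℂ := fun θ => deriv (circleMap 0 r) θ * (1 / (circleMap 0 r θ - 0) ^ 2) with hcdef
  have hc : Continuous c := by
    have h0 : ∀ θ, (circleMap 0 r θ - 0) ^ 2 ≠ 0 := fun θ => by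
      simpa using hr0.ne'
    simp only [hcdef, deriv_circleMap]
    exact (by fun_prop : Continuous fun θ => circleMap 0 r θ * Complex.I).mul
      (continuous_const.div (by fun_prop) h0)
  have hline : ∀ y ∈ Metric.ball x (ε / 2), ∀ ζ : ℂ, ‖ζ‖ ≤ r →
      HasDerivAt (fun ζ : ℂ => f (y + ζ • v)) (fderiv ℂ f (y + ζ • v) v) ζ := by
    intro y hy ζ hζ
    have h1 : HasDerivAt (fun ζ : ℂ => y + ζ • v) v ζ := by
      simpa using ((hasDerivAt_id ζ).smul_const v).const_add y
    exact (hdiff _ (hmem y hy ζ hζ)).hasFDerivAt.comp_hasDerivAt ζ h1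
  have hformula : ∀ y ∈ Metric.ball x (ε / 2), fderiv ℂ f y v =
      (2 * Real.pi * Complex.I : ℂ)⁻¹ •
        ∫ θ in (0 : ℝ)..2 * Real.pi, c θ • f (y + circleMap 0 r θ • v) := by
    intro y hy
    have hdc : DiffContOnCl ℂ (fun ζ : ℂ => f (y + ζ • v)) (Metric.ball 0 r) := by
      refine DifferentiableOn.diffContOnCl fun ζ hζ => ?_
      rw [closure_ball _ hr0.ne'] at hζ
      exact (hline y hy ζ (by simpa using hζ)).differentiableAt.differentiableWithinAt
    have key := hdc.circleIntegral_one_div_sub_center_pow_smul hr0 1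
    have hd := (hline y hy 0 (by simpa using hr0.le)).deriv
    rw [iteratedDeriv_one, hd] at key
    simp only [circleIntegral, smul_smul] at key
    simp only [hcdef]
    rw [key, Nat.factorial_one, Nat.cast_one, div_one,
      inv_smul_smul₀ Complex.two_pi_I_ne_zero, zero_smul, add_zero]
  have hcont : ∀ y ∈ Metric.ball x (ε / 2),
      Continuous fun θ : ℝ => c θ • f (y + circleMap 0 r θ • v) := by
    intro y hy
    refine hc.smul (continuous_iff_continuousAt.2 fun θ => ?_)
    exact (hdiff _ (hmem y hy _ (hcircle θ))).continuousAt.comp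
      (f := fun θ : ℝ => y + circleMap 0 r θ • v) (by fun_prop)
  have hnhds : Metric.ball x (ε / 2) ∈ 𝓝 x := Metric.ball_mem_nhds _ (half_pos hε)
  have hasDeriv := intervalIntegral.hasFDerivAt_integral_of_dominated_of_fderiv_le (𝕜 := ℂ)
    (μ := MeasureTheory.volume) (a := 0) (b := 2 * Real.pi)
    (F := fun y θ => c θ • f (y + circleMap 0 r θ • v))
    (F' := fun y θ => c θ • fderiv ℂ f (y + circleMap 0 r θ • v))
    (bound := fun θ => ‖c θ‖ * C) hnhds
    (by filter_upwards [hnhds] with y hy using (hcont y hy).aestronglyMeasurable)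
    ((hcont x (Metric.mem_ball_self (half_pos hε))).intervalIntegrable _ _)
    (by
      refine (hc.aestronglyMeasurable).smul (Measurable.aestronglyMeasurable ?_)
      exact (measurable_fderiv ℂ f).comp (by fun_prop : Continuous fun θ : ℝ =>
        x + circleMap 0 r θ • v).measurable)
    (.of_forall fun θ _ y hy => by
      rw [norm_smul]
      gcongr
      exact (hball (hmem y hy _ (hcircle θ))).2)
    ((hc.norm.mul continuous_const).intervalIntegrable _ _)
    (.of_forall fun θ _ y hy => by
      have h1 : HasFDerivAt (fun y : E => y + circleMap 0 r θ • v) (.id ℂ E) y :=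
        (hasFDerivAt_id y).add_const _
      exact ((hdiff _ (hmem y hy _ (hcircle θ))).hasFDerivAt.comp y h1).const_smul (c θ))
  refine (hasDeriv.differentiableAt.const_smul
    ((2 * Real.pi * Complex.I : ℂ)⁻¹)).congr_of_eventuallyEq ?_
  filter_upwards [hnhds] with y hy using hformula y hy

/-- A holomorphic map of several variables is `C^n` for every `n`. -/
theorem contDiffOn_of_differentiableOn_complex {E F : Type*}
    [NormedAddCommGroup E] [NormedSpace ℂ E] [FiniteDimensional ℂ E]
    [NormedAddCommGroup F] [NormedSpace ℂ F] [FiniteDimensional ℂ F]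
    {f : E → F} {U : Set E} (hf : DifferentiableOn ℂ f U) (hU : IsOpen U) (n : ℕ) :
    ContDiffOn ℂ n f U := by
  induction n generalizing f with
  | zero => simpa using hf.continuousOn
  | succ n ih =>
    push_cast
    exact (contDiffOn_succ_iff_fderiv_of_isOpen hU).2
      ⟨hf, by simp, contDiffOn_clm_apply.2 fun v => ih (differentiableOn_fderiv_apply hf hU v)⟩

/-- By Cauchy's estimate, applying a vector field lowers the order of vanishing by at most one. -/
theorem isLittleO_applyVF {E : Type*} [NormedAddCommGroup E] [NormedSpace ℂ E]
    {f : E → ℂ} {U : Set E} (hf : DifferentiableOn ℂ f U) (hU : IsOpen U) (hU0 : (0 : E) ∈ U)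
    {X : E → E} (hX : ContinuousAt X 0) {N : ℕ} (h : f =o[𝓝 0] fun Z : E => ‖Z‖ ^ (N + 1)) :
    applyVF X f =o[𝓝 0] fun Z : E => ‖Z‖ ^ N := by
  have hderiv : fderiv ℂ f =o[𝓝 0] fun Z : E => ‖Z‖ ^ N := by
    rw [isLittleO_iff]
    intro c hc
    have hc' : 0 < c / (2 ^ (N + 1) + 1) := by positivity
    obtain ⟨ε, hε, hball⟩ := Metric.mem_nhds_iff.1
      (Filter.inter_mem (hU.mem_nhds hU0) ((isLittleO_iff.1 h) hc'))
    filter_upwards [Metric.ball_mem_nhds (0 : E) (half_pos hε)] with Z hZ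
    rw [mem_ball_zero_iff] at hZ
    rw [norm_pow, norm_norm]
    rcases eq_or_ne Z 0 with rfl | hZ0
    · have h0 : f 0 = 0 := by simpa using (hball (Metric.mem_ball_self hε)).2
      have hd : HasFDerivAt f (0 : E →L[ℂ] ℂ) 0 := by
        refine .of_isLittleO ?_
        simp only [h0, sub_zero, zero_apply]
        refine h.trans_isBigO (IsBigO.of_bound 1 ?_)
        filter_upwards [Metric.ball_mem_nhds (0 : E) one_pos] with z hz
        rw [mem_ball_zero_iff] at hz
        rw [norm_pow, norm_norm, one_mul]
        exact pow_le_of_le_one (norm_nonneg _) hz.le N.succ_ne_zero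
      rw [hd.fderiv, norm_zero]
      positivity
    · have hr : 0 < ‖Z‖ := norm_pos_iff.2 hZ0
      have hsub : ∀ z ∈ Metric.ball Z ‖Z‖, ‖z‖ < 2 * ‖Z‖ := fun z hz => by
        have := norm_le_norm_add_norm_sub' z Z
        rw [Metric.mem_ball, dist_eq_norm_sub] at hz
        linarith
      have hin : ∀ z, ‖z‖ < 2 * ‖Z‖ → z ∈ Metric.ball (0 : E) ε := fun z hz => by
        rw [mem_ball_zero_iff]; linarith
      have hbd : ∀ z, ‖z‖ < 2 * ‖Z‖ →
          ‖f z‖ ≤ c / (2 ^ (N + 1) + 1) * ‖z‖ ^ (N + 1) := fun z hz => by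
        simpa using (hball (hin z hz)).2
      have hmaps : Set.MapsTo f (Metric.ball Z ‖Z‖)
          (Metric.closedBall (f Z) (c * ‖Z‖ ^ (N + 1))) := fun z hz => by
        rw [Metric.mem_closedBall, dist_eq_norm_sub]
        have hz' := hsub z hz
        calc ‖f z - f Z‖ ≤ ‖f z‖ + ‖f Z‖ := norm_sub_le _ _
          _ ≤ c / (2 ^ (N + 1) + 1) * (2 * ‖Z‖) ^ (N + 1)
              + c / (2 ^ (N + 1) + 1) * ‖Z‖ ^ (N + 1) := by
            refine add_le_add ((hbd z hz').trans ?_) (hbd Z (by linarith))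
            gcongr
          _ = c * ‖Z‖ ^ (N + 1) := by rw [mul_pow]; field_simp
      refine (Complex.norm_fderiv_le_div_of_mapsTo_ball
        (hf.mono fun z hz => (hball (hin z (hsub z hz))).1) hmaps hr).trans_eq ?_
      rw [pow_succ]
      field_simp
  have hle : applyVF X f =O[𝓝 0] fun Z => ‖fderiv ℂ f Z‖ * ‖X Z‖ :=
    .of_bound 1 (.of_forall fun Z => by
      simpa [applyVF] using (fderiv ℂ f Z).le_opNorm (X Z))
  have hX1 : (fun Z => ‖X Z‖) =O[𝓝 0] fun _ => (1 : ℝ) := hX.norm.isBigO_one ℝ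
  simpa using hle.trans_isLittleO (hderiv.norm_left.mul_isBigO hX1)

theorem differentiableOn_applyVF {E : Type*} [NormedAddCommGroup E] [NormedSpace ℂ E]
    [FiniteDimensional ℂ E] {f : E → ℂ} {X : E → E} {U : Set E} (hU : IsOpen U)
    (hf : DifferentiableOn ℂ f U) (hX : DifferentiableOn ℂ X U) :
    DifferentiableOn ℂ (applyVF X f) U := by
  have h2 := contDiffOn_of_differentiableOn_complex hf hU 2
  have h1 := (contDiffOn_succ_iff_fderiv_of_isOpen (n := 1) hU).1 (by rwa [one_add_one_eq_two])
  exact (h1.2.2.differentiableOn one_ne_zero).clm_apply hX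

theorem differentiableOn_iterApplyVF {E : Type*} [NormedAddCommGroup E] [NormedSpace ℂ E]
    [FiniteDimensional ℂ E] {f : E → ℂ} {U : Set E} (hU : IsOpen U)
    (hf : DifferentiableOn ℂ f U) {l : List (E → E)} (hl : ∀ X ∈ l, DifferentiableOn ℂ X U) :
    DifferentiableOn ℂ (iterApplyVF l f) U := by
  induction l with
  | nil => exact hf
  | cons X l ih =>
    exact differentiableOn_applyVF hU (ih fun Y hY => hl Y (by simp [hY])) (hl X (by simp))

/-- The commutator of two derivations vanishes to the same order as the Lie bracket. -/
theorem isLittleO_applyVF_applyVF_sub {E : Type*} [NormedAddCommGroup E] [NormedSpace ℂ E]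
    [FiniteDimensional ℂ E] {f : E → ℂ} {X Y : E → E} {U : Set E} (hU : IsOpen U)
    (hU0 : (0 : E) ∈ U) (hf : DifferentiableOn ℂ f U) (hX : DifferentiableOn ℂ X U)
    (hY : DifferentiableOn ℂ Y U) {k : ℕ}
    (hXY : lieBracketVF X Y =o[𝓝 0] fun Z : E => ‖Z‖ ^ k) :
    (fun Z => applyVF X (applyVF Y f) Z - applyVF Y (applyVF X f) Z)
      =o[𝓝 0] fun Z : E => ‖Z‖ ^ k := by
  have heq : (fun Z => applyVF X (applyVF Y f) Z - applyVF Y (applyVF X f) Z)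
      =ᶠ[𝓝 0] applyVF (lieBracketVF X Y) f := by
    filter_upwards [hU.mem_nhds hU0] with Z hZ
    have h2 := (contDiffOn_of_differentiableOn_complex hf hU 2).contDiffAt (hU.mem_nhds hZ)
    exact (VectorField.fderiv_apply_lieBracket h2 (by simp)
      (hY.differentiableAt (hU.mem_nhds hZ)) (hX.differentiableAt (hU.mem_nhds hZ))).symm
  refine heq.trans_isLittleO ?_
  obtain ⟨C, hC⟩ := exists_eventually_norm_fderiv_le hf hU hU0
  refine IsBigO.trans_isLittleO (.of_bound C ?_) hXY
  filter_upwards [hC] with Z hZ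
  exact (fderiv ℂ f Z).le_of_opNorm_le hZ _

/-- Permuting at most `k + 2` vector fields whose brackets are `o(‖Z‖ ^ k)` changes an iterated
derivative of order `s` by `o(‖Z‖ ^ (k + 2 - s))`. -/
theorem List.Perm.isLittleO_iterApplyVF_sub {E I : Type*} [NormedAddCommGroup E]
    [NormedSpace ℂ E] [FiniteDimensional ℂ E] {f : E → ℂ} {L : I → E → E} {U : Set E}
    (hU : IsOpen U) (hU0 : (0 : E) ∈ U) (hf : DifferentiableOn ℂ f U)
    (hL : ∀ i, DifferentiableOn ℂ (L i) U) {k : ℕ}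
    (hbracket : ∀ i j, lieBracketVF (L i) (L j) =o[𝓝 0] fun Z : E => ‖Z‖ ^ k)
    {l₁ l₂ : List I} (h : l₁.Perm l₂) (hk : l₁.length ≤ k + 2) :
    (fun Z => iterApplyVF (l₁.map L) f Z - iterApplyVF (l₂.map L) f Z)
      =o[𝓝 0] fun Z : E => ‖Z‖ ^ (k + 2 - l₁.length) := by
  have hiter : ∀ l : List I, DifferentiableOn ℂ (iterApplyVF (l.map L) f) U := fun l =>
    differentiableOn_iterApplyVF hU hf fun X hX => by
      obtain ⟨i, -, rfl⟩ := List.mem_map.1 hX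
      exact hL i
  induction h with
  | nil => simp
  | cons i p ih =>
    rename_i l₁ l₂
    rw [List.length_cons] at hk
    have h1 := ih (by omega)
    rw [show k + 2 - l₁.length = k + 2 - (l₁.length + 1) + 1 by omega] at h1
    refine Filter.EventuallyEq.trans_isLittleO ?_ (isLittleO_applyVF ((hiter l₁).sub (hiter l₂)) hU hU0
      ((hL i).differentiableAt (hU.mem_nhds hU0)).continuousAt h1)
    filter_upwards [hU.mem_nhds hU0] with Z hZ
    have h2 := fderiv_fun_sub ((hiter l₁).differentiableAt (hU.mem_nhds hZ))
      ((hiter l₂).differentiableAt (hU.mem_nhds hZ))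
    exact (DFunLike.congr_fun h2 (L i Z)).symm
  | swap i j l =>
    refine (isLittleO_applyVF_applyVF_sub hU hU0 (hiter l) (hL j) (hL i)
      (hbracket j i)).trans_isBigO (.of_bound 1 ?_)
    filter_upwards [Metric.ball_mem_nhds (0 : E) one_pos] with Z hZ
    rw [mem_ball_zero_iff] at hZ
    rw [norm_pow, norm_pow, norm_norm, one_mul]
    refine pow_le_pow_of_le_one (norm_nonneg _) hZ.le ?_
    simp
  | trans p₁ p₂ ih₁ ih₂ =>
    have h2 := ih₂ (p₁.length_eq ▸ hk)
    rw [← p₁.length_eq] at h2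
    simpa using (ih₁ hk).add h2

/-- If `L_i = ∂/∂z_i + Σ_j a_i^j(z,w) ∂/∂w_j` are holomorphic vector fields near `0` in
`ℂ^m = ℂ^n_z × ℂ^{m−n}_w` with `[L_i, L_j](Z) = o(|Z|^k)`, then for every holomorphic `g`,
every `1 ≤ s ≤ k+2`, all indices `i₁, …, i_s` and every permutation `σ` of `{1, …, s}`,
`(L_{i₁} ⋯ L_{i_s} g)(0, w) = (L_{i_{σ(1)}} ⋯ L_{i_{σ(s)}} g)(0, w) + o(|w|^{k+2−s})`. -/
theorem approx_commuting_vector_fields_permute {n p k : ℕ}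
    (U : Set ((Fin n → ℂ) × (Fin p → ℂ))) (hU : IsOpen U)
    (hU0 : (0 : (Fin n → ℂ) × (Fin p → ℂ)) ∈ U)
    (a : Fin n → ((Fin n → ℂ) × (Fin p → ℂ)) → (Fin p → ℂ))
    (ha : ∀ i, DifferentiableOn ℂ (a i) U)
    (L : Fin n → ((Fin n → ℂ) × (Fin p → ℂ)) → ((Fin n → ℂ) × (Fin p → ℂ)))
    (hL : ∀ i Z, L i Z = (Pi.single i 1, a i Z))
    (hbracket : ∀ i j,
      (fun Z => lieBracketVF (L i) (L j) Z)
        =o[𝓝 0] fun Z : (Fin n → ℂ) × (Fin p → ℂ) => ‖Z‖ ^ k)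
    (g : ((Fin n → ℂ) × (Fin p → ℂ)) → ℂ) (hg : DifferentiableOn ℂ g U)
    (s : ℕ) (hs1 : 1 ≤ s) (hs2 : s ≤ k + 2)
    (ι : Fin s → Fin n) (σ : Equiv.Perm (Fin s)) :
    (fun w : Fin p → ℂ =>
        iterApplyVF (List.ofFn fun t => L (ι t)) g (0, w)
          - iterApplyVF (List.ofFn fun t => L (ι (σ t))) g (0, w))
      =o[𝓝 0] fun w : Fin p → ℂ => ‖w‖ ^ (k + 2 - s) := by
  have hLd : ∀ i, DifferentiableOn ℂ (L i) U := fun i => by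
    rw [show L i = fun Z => (Pi.single i 1, a i Z) from funext (hL i)]
    exact (differentiableOn_const _).prodMk (ha i)
  have hperm : (List.ofFn ι).Perm (List.ofFn (ι ∘ σ)) := (σ.ofFn_comp_perm ι).symm
  have h := hperm.isLittleO_iterApplyVF_sub hU hU0 hg hLd hbracket (by simpa using hs2)
  have ht : Filter.Tendsto (fun w : Fin p → ℂ => ((0 : Fin n → ℂ), w)) (𝓝 0) (𝓝 0) :=
    Continuous.tendsto' (by fun_prop) _ _ rfl
  simpa [Function.comp_def, List.map_ofFn] using h.comp_tendsto ht
end
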